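/- Let σ > 0, β > 0 with 2β + 1 < 3σ. Then there exists ρ > 1 such that the Lorenz system with parameters (σ, ρ, β) possesses a homoclinic trajectory to the origin, i.e. a nonconstant differentiable solution u : ℝ → ℝ³ with u(t) → 0 as t → +∞ and as t → −∞. -/

import Mathlib

open Filter Topology

/-- Right-hand side of the Lorenz system with parameters `σ ρ β`:
`ẋ = σ(y − x), ẏ = ρx − y − xz, ż = −βz + xy`. -/
def lorenzRHS (σ ρ β : ℝ) (p : ℝ × ℝ × ℝ) : ℝ × ℝ × ℝ :=
  (σ * (p.2.1 - p.1), ρ * p.1 - p.2.1 - p.1 * p.2.2, -β * p.2.2 + p.1 * p.2.1)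

/-! ### Elementary comparison lemmas on the real line -/

theorem mul_exp_le_of_deriv_add_nonneg {f f' : ℝ → ℝ} {a b : ℝ} (k : ℝ) (hab : a ≤ b)
    (hf : ∀ t ∈ Set.Icc a b, HasDerivAt f (f' t) t)
    (h : ∀ t ∈ Set.Ioo a b, 0 ≤ f' t + k * f t) :
    f a * Real.exp (k * a) ≤ f b * Real.exp (k * b) := by
  have hd : ∀ t ∈ Set.Icc a b, HasDerivAt (fun t => f t * Real.exp (k * t))
      ((f' t + k * f t) * Real.exp (k * t)) t := by
    intro t ht
    have h1 : HasDerivAt (fun t => Real.exp (k * t)) (Real.exp (k * t) * k) t := by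
      simpa using ((hasDerivAt_id t).const_mul k).exp
    exact ((hf t ht).mul h1).congr_deriv (by ring)
  refine monotoneOn_of_deriv_nonneg (convex_Icc a b)
    (fun t ht => (hd t ht).continuousAt.continuousWithinAt) ?_ ?_
    (Set.left_mem_Icc.2 hab) (Set.right_mem_Icc.2 hab) hab
  · intro t ht
    rw [interior_Icc] at ht
    exact (hd t (Set.Ioo_subset_Icc_self ht)).differentiableAt.differentiableWithinAt
  · intro t ht
    rw [interior_Icc] at ht
    rw [(hd t (Set.Ioo_subset_Icc_self ht)).deriv]
    exact mul_nonneg (h t ht) (Real.exp_pos _).le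

theorem mul_exp_lt_of_deriv_add_pos {f f' : ℝ → ℝ} {a b : ℝ} (k : ℝ) (hab : a < b)
    (hf : ∀ t ∈ Set.Icc a b, HasDerivAt f (f' t) t)
    (h : ∀ t ∈ Set.Ioo a b, 0 < f' t + k * f t) :
    f a * Real.exp (k * a) < f b * Real.exp (k * b) := by
  have hd : ∀ t ∈ Set.Icc a b, HasDerivAt (fun t => f t * Real.exp (k * t))
      ((f' t + k * f t) * Real.exp (k * t)) t := by
    intro t ht
    have h1 : HasDerivAt (fun t => Real.exp (k * t)) (Real.exp (k * t) * k) t := by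
      simpa using ((hasDerivAt_id t).const_mul k).exp
    exact ((hf t ht).mul h1).congr_deriv (by ring)
  refine strictMonoOn_of_deriv_pos (convex_Icc a b)
    (fun t ht => (hd t ht).continuousAt.continuousWithinAt) ?_
    (Set.left_mem_Icc.2 hab.le) (Set.right_mem_Icc.2 hab.le) hab
  intro t ht
  rw [interior_Icc] at ht
  rw [(hd t (Set.Ioo_subset_Icc_self ht)).deriv]
  exact mul_pos (h t ht) (Real.exp_pos _)

theorem le_of_deriv_nonneg {f f' : ℝ → ℝ} {a b : ℝ} (hab : a ≤ b)
    (hf : ∀ t ∈ Set.Icc a b, HasDerivAt f (f' t) t)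
    (h : ∀ t ∈ Set.Ioo a b, 0 ≤ f' t) : f a ≤ f b := by
  simpa using mul_exp_le_of_deriv_add_nonneg 0 hab hf (by simpa using h)

theorem le_of_deriv_nonpos {f f' : ℝ → ℝ} {a b : ℝ} (hab : a ≤ b)
    (hf : ∀ t ∈ Set.Icc a b, HasDerivAt f (f' t) t)
    (h : ∀ t ∈ Set.Ioo a b, f' t ≤ 0) : f b ≤ f a := by
  have := le_of_deriv_nonneg hab (fun t ht => (hf t ht).neg)
    (fun t ht => neg_nonneg.2 (h t ht))
  simpa using this

theorem pos_of_deriv_add_nonneg {f f' : ℝ → ℝ} {a b : ℝ} (k : ℝ) (hab : a ≤ b)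
    (hf : ∀ t ∈ Set.Icc a b, HasDerivAt f (f' t) t)
    (h : ∀ t ∈ Set.Ioo a b, 0 ≤ f' t + k * f t) (ha : 0 < f a) : 0 < f b := by
  have h1 := mul_exp_le_of_deriv_add_nonneg k hab hf h
  exact pos_of_mul_pos_left (lt_of_lt_of_le (mul_pos ha (Real.exp_pos _)) h1) (Real.exp_pos _).le

theorem nonneg_of_deriv_add_nonneg {f f' : ℝ → ℝ} {a b : ℝ} (k : ℝ) (hab : a ≤ b)
    (hf : ∀ t ∈ Set.Icc a b, HasDerivAt f (f' t) t)
    (h : ∀ t ∈ Set.Ioo a b, 0 ≤ f' t + k * f t) (ha : 0 ≤ f a) : 0 ≤ f b := by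
  have h1 := mul_exp_le_of_deriv_add_nonneg k hab hf h
  exact nonneg_of_mul_nonneg_left (le_trans (mul_nonneg ha (Real.exp_pos _).le) h1)
    (Real.exp_pos _)

theorem neg_of_deriv_add_nonpos {f f' : ℝ → ℝ} {a b : ℝ} (k : ℝ) (hab : a ≤ b)
    (hf : ∀ t ∈ Set.Icc a b, HasDerivAt f (f' t) t)
    (h : ∀ t ∈ Set.Ioo a b, f' t + k * f t ≤ 0) (ha : f a < 0) : f b < 0 := by
  have := pos_of_deriv_add_nonneg k hab (fun t ht => (hf t ht).neg)
    (fun t ht => by have := h t ht; simp only [Pi.neg_apply]; linarith) (by simpa using ha)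
  simpa using this

theorem nonpos_of_deriv_add_nonpos {f f' : ℝ → ℝ} {a b : ℝ} (k : ℝ) (hab : a ≤ b)
    (hf : ∀ t ∈ Set.Icc a b, HasDerivAt f (f' t) t)
    (h : ∀ t ∈ Set.Ioo a b, f' t + k * f t ≤ 0) (ha : f a ≤ 0) : f b ≤ 0 := by
  have := nonneg_of_deriv_add_nonneg k hab (fun t ht => (hf t ht).neg)
    (fun t ht => by have := h t ht; simp only [Pi.neg_apply]; linarith) (by simpa using ha)
  simpa using this

theorem exists_last_eq {f : ℝ → ℝ} {a b m : ℝ} (hab : a ≤ b) (hf : ContinuousOn f (Set.Icc a b))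
    (ha : m ≤ f a) (hb : f b < m) :
    ∃ s, a ≤ s ∧ s < b ∧ f s = m ∧ ∀ t, s < t → t ≤ b → f t < m := by
  set S := Set.Icc a b ∩ f ⁻¹' Set.Ici m with hS
  have hSc : IsCompact S :=
    isCompact_Icc.of_isClosed_subset (hf.preimage_isClosed_of_isClosed isClosed_Icc isClosed_Ici)
      Set.inter_subset_left
  have hne : S.Nonempty := ⟨a, ⟨le_rfl, hab⟩, ha⟩
  obtain ⟨s, ⟨⟨has, hsb⟩, hms⟩, hmax⟩ := hSc.exists_isGreatest hne
  have hms : m ≤ f s := hms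
  have hlt : ∀ t, s < t → t ≤ b → f t < m := by
    intro t hst htb
    by_contra hcon
    exact absurd (hmax ⟨⟨has.trans hst.le, htb⟩, not_lt.1 hcon⟩) (not_le.2 hst)
  have hsb' : s < b := lt_of_le_of_ne hsb (by rintro rfl; linarith)
  refine ⟨s, has, hsb', ?_, hlt⟩
  by_contra hne'
  have hgt : m < f s := lt_of_le_of_ne hms (Ne.symm hne')
  obtain ⟨t, ht, hft⟩ := intermediate_value_Icc' hsb
    (hf.mono (Set.Icc_subset_Icc_left has)) ⟨hb.le, hms⟩
  rcases eq_or_lt_of_le ht.1 with h1 | h1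
  · subst h1; linarith
  · have := hlt t h1 ht.2; linarith

theorem exists_first_eq {f : ℝ → ℝ} {a b m : ℝ} (hab : a ≤ b) (hf : ContinuousOn f (Set.Icc a b))
    (ha : f a < m) (hb : m ≤ f b) :
    ∃ s, a < s ∧ s ≤ b ∧ f s = m ∧ ∀ t, a ≤ t → t < s → f t < m := by
  have hc : ContinuousOn (fun t => f (-t)) (Set.Icc (-b) (-a)) :=
    hf.comp continuousOn_neg (fun t ht => ⟨by linarith [ht.2], by linarith [ht.1]⟩)
  obtain ⟨s, h1, h2, h3, h4⟩ := exists_last_eq (m := m) (neg_le_neg hab) hc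
    (by simpa using hb) (by simpa using ha)
  exact ⟨-s, by linarith, by linarith, h3,
    fun t h5 h6 => by simpa using h4 (-t) (by linarith) (by linarith)⟩

/-- If `f` does not decrease while it is below `c`, then it cannot cross a level `m ≤ c`
downwards. -/
theorem le_of_deriv_nonneg_below {f f' : ℝ → ℝ} {a b m c : ℝ} (hab : a ≤ b)
    (hf : ∀ t ∈ Set.Icc a b, HasDerivAt f (f' t) t)
    (h : ∀ t ∈ Set.Icc a b, f t < c → 0 ≤ f' t) (ha : m ≤ f a) (hmc : m ≤ c) : m ≤ f b := by
  by_contra hcon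
  obtain ⟨s, h1, h2, h3, h4⟩ := exists_last_eq hab
    (fun t ht => (hf t ht).continuousAt.continuousWithinAt) ha (not_le.1 hcon)
  have := le_of_deriv_nonneg h2.le (fun t ht => hf t ⟨h1.trans ht.1, ht.2⟩)
    (fun t ht => h t ⟨h1.trans ht.1.le, ht.2.le⟩ ((h4 t ht.1 ht.2.le).trans_le hmc))
  linarith

theorem le_of_deriv_nonpos_below {f f' : ℝ → ℝ} {a b m c : ℝ} (hab : a ≤ b)
    (hf : ∀ t ∈ Set.Icc a b, HasDerivAt f (f' t) t)
    (h : ∀ t ∈ Set.Icc a b, f t < c → f' t ≤ 0) (hb : m ≤ f b) (hmc : m ≤ c) : m ≤ f a := by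
  have key := le_of_deriv_nonneg_below (f := fun t => f (-t)) (f' := fun t => -f' (-t))
    (m := m) (c := c) (neg_le_neg hab) ?_ ?_ (by simpa using hb) hmc
  · simpa using key
  · intro t ht
    have := (hf (-t) ⟨by linarith [ht.2], by linarith [ht.1]⟩).comp t (hasDerivAt_neg t)
    exact this.congr_deriv (by ring)
  · intro t ht hlt
    exact neg_nonneg.2 (h (-t) ⟨by linarith [ht.2], by linarith [ht.1]⟩ hlt)

theorem eventually_sign_of_deriv_pos {f : ℝ → ℝ} {f' t₀ : ℝ} (hf : HasDerivAt f f' t₀)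
    (h' : 0 < f') (h0 : f t₀ = 0) :
    (∀ᶠ t in 𝓝[<] t₀, f t < 0) ∧ (∀ᶠ t in 𝓝[>] t₀, 0 < f t) := by
  have h := eventually_nhdsWithin_sign_eq_of_deriv_pos (f := f) (x₀ := t₀)
    (by rw [hf.deriv]; exact h') h0
  constructor
  · filter_upwards [nhdsWithin_le_nhds h, self_mem_nhdsWithin] with t ht hlt
    have hlt : t < t₀ := hlt
    rw [sign_neg (sub_neg.2 hlt)] at ht
    exact sign_eq_neg_one_iff.1 ht
  · filter_upwards [nhdsWithin_le_nhds h, self_mem_nhdsWithin] with t ht hlt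
    have hlt : t₀ < t := hlt
    rw [sign_pos (sub_pos.2 hlt)] at ht
    exact sign_eq_one_iff.1 ht

theorem eventually_sign_of_deriv_neg {f : ℝ → ℝ} {f' t₀ : ℝ} (hf : HasDerivAt f f' t₀)
    (h' : f' < 0) (h0 : f t₀ = 0) :
    (∀ᶠ t in 𝓝[<] t₀, 0 < f t) ∧ (∀ᶠ t in 𝓝[>] t₀, f t < 0) := by
  have := eventually_sign_of_deriv_pos hf.neg (neg_pos.2 h') (by simp [h0])
  simpa using this

/-! ### Global flows of bounded Lipschitz fields -/

section Flow

variable {E : Type*} [NormedAddCommGroup E] [NormedSpace ℝ E]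

theorem exists_global_solution [CompleteSpace E] {F : E → E} {K : NNReal} (hF : LipschitzWith K F)
    {C : ℝ} (hC : ∀ p, ‖F p‖ ≤ C) (p : E) :
    ∃ u : ℝ → E, u 0 = p ∧ ∀ t, HasDerivAt u (F (u t)) t := by
  have hC0 : 0 ≤ C := (norm_nonneg _).trans (hC p)
  have loc : ∀ N : ℕ, ∃ u : ℝ → E, u 0 = p ∧ ∀ t ∈ Set.Ioo (-(N : ℝ) - 1) (N + 1),
      HasDerivAt u (F (u t)) t := by
    intro N
    have hN : (0 : ℝ) ≤ N := N.cast_nonneg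
    have hPL : IsPicardLindelof (fun _ : ℝ => F) (tmin := -(N : ℝ) - 1) (tmax := N + 1)
        ⟨0, by constructor <;> linarith⟩ p ⟨C * (N + 1), by positivity⟩ 0 ⟨C, hC0⟩ K := by
      refine ⟨fun t _ => hF.lipschitzOnWith, fun x _ => continuousOn_const,
        fun t _ x _ => hC x, ?_⟩
      have : max ((N : ℝ) + 1 - 0) (0 - (-(N : ℝ) - 1)) = N + 1 := by
        rw [max_eq_left] <;> linarith
      change C * max ((N : ℝ) + 1 - 0) (0 - (-(N : ℝ) - 1)) ≤ C * (N + 1) - 0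
      rw [this, sub_zero]
    obtain ⟨u, h0, hu⟩ := hPL.exists_eq_forall_mem_Icc_hasDerivWithinAt₀
    exact ⟨u, h0, fun t ht => (hu t (Set.Ioo_subset_Icc_self ht)).hasDerivAt
      (Icc_mem_nhds ht.1 ht.2)⟩
  choose u h0 hu using loc
  have agree : ∀ M N : ℕ, M ≤ N → ∀ t ∈ Set.Ioo (-(M : ℝ) - 1) (M + 1), u N t = u M t := by
    intro M N hMN t ht
    have hM : (0 : ℝ) ≤ M := M.cast_nonneg
    have hMN' : (M : ℝ) ≤ N := by exact_mod_cast hMN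
    refine ODE_solution_unique_of_mem_Ioo (v := fun _ => F) (s := fun _ => Set.univ) (K := K)
      (t₀ := 0) (a := -(M : ℝ) - 1) (b := M + 1)
      (fun t _ => hF.lipschitzOnWith) ⟨by linarith, by linarith⟩
      (fun t ht => ⟨hu N t ⟨by linarith [ht.1], by linarith [ht.2]⟩, trivial⟩)
      (fun t ht => ⟨hu M t ht, trivial⟩) ((h0 N).trans (h0 M).symm) ht
  refine ⟨fun t => u ⌈|t|⌉₊ t, by simp [h0], fun t => ?_⟩
  have hmem : ∀ s, s ∈ Set.Ioo (-((⌈|s|⌉₊ : ℕ) : ℝ) - 1) (⌈|s|⌉₊ + 1) := by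
    intro s
    have h1 := abs_le.1 (Nat.le_ceil |s|)
    exact ⟨by linarith [h1.1], by linarith [h1.2]⟩
  have hev : (fun s => u ⌈|s|⌉₊ s) =ᶠ[𝓝 t] u (⌈|t|⌉₊ + 1) := by
    have h1 : ∀ᶠ s : ℝ in 𝓝 t, |s| < (⌈|t|⌉₊ : ℝ) + 1 :=
      continuous_abs.continuousAt.eventually_lt continuousAt_const
        (by have := Nat.le_ceil |t|; linarith)
    filter_upwards [h1] with s hs
    have hle : ⌈|s|⌉₊ ≤ ⌈|t|⌉₊ + 1 := Nat.ceil_le.2 (by push_cast; exact hs.le)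
    exact (agree _ _ hle s (hmem s)).symm
  have h2 := hu (⌈|t|⌉₊ + 1) t (by
    have := hmem t
    push_cast
    exact ⟨by linarith [this.1], by linarith [this.2]⟩)
  have h3 := h2.congr_of_eventuallyEq hev
  rwa [← hev.eq_of_nhds] at h3

theorem dist_trajectories_le {F : E → E} {K : NNReal} (hF : LipschitzWith K F)
    {u v : ℝ → E} (hu : ∀ t, HasDerivAt u (F (u t)) t) (hv : ∀ t, HasDerivAt v (F (v t)) t)
    (t : ℝ) : dist (u t) (v t) ≤ dist (u 0) (v 0) * Real.exp (K * |t|) := by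
  have key : ∀ {G : E → E} {u v : ℝ → E}, LipschitzWith K G →
      (∀ t, HasDerivAt u (G (u t)) t) → (∀ t, HasDerivAt v (G (v t)) t) → ∀ t, 0 ≤ t →
      dist (u t) (v t) ≤ dist (u 0) (v 0) * Real.exp (K * t) := by
    intro G u v hG hu hv t ht
    have := dist_le_of_trajectories_ODE (v := fun _ => G) (K := K) (f := u) (g := v)
      (a := 0) (b := t) (δ := dist (u 0) (v 0)) (fun _ => hG)
      (fun s _ => (hu s).continuousAt.continuousWithinAt)
      (fun s _ => (hu s).hasDerivWithinAt)
      (fun s _ => (hv s).continuousAt.continuousWithinAt)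
      (fun s _ => (hv s).hasDerivWithinAt) le_rfl t ⟨ht, le_rfl⟩
    simpa using this
  rcases le_total 0 t with ht | ht
  · rw [abs_of_nonneg ht]
    exact key hF hu hv t ht
  · rw [abs_of_nonpos ht]
    have rev : ∀ {u : ℝ → E}, (∀ t, HasDerivAt u (F (u t)) t) →
        ∀ t, HasDerivAt (fun s => u (-s)) ((fun p => -F p) (u (-t))) t := by
      intro u hu t
      exact ((hu (-t)).scomp t (hasDerivAt_neg t)).congr_deriv (by simp)
    have := key (u := fun s => u (-s)) (v := fun s => v (-s)) hF.neg (rev hu) (rev hv) (-t)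
      (by linarith)
    simpa using this

theorem trajectory_unique {F : E → E} {K : NNReal} (hF : LipschitzWith K F)
    {u v : ℝ → E} (hu : ∀ t, HasDerivAt u (F (u t)) t) (hv : ∀ t, HasDerivAt v (F (v t)) t)
    (h : u 0 = v 0) : u = v := by
  funext t
  have := dist_trajectories_le hF hu hv t
  rw [h, dist_self, zero_mul] at this
  exact dist_le_zero.1 this

theorem exists_flow [CompleteSpace E] {F : E → E} {K : NNReal} (hF : LipschitzWith K F)
    {C : ℝ} (hC : ∀ p, ‖F p‖ ≤ C) :
    ∃ Φ : E → ℝ → E, (∀ p, Φ p 0 = p) ∧ (∀ p t, HasDerivAt (Φ p) (F (Φ p t)) t) ∧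
      (∀ p s t, Φ (Φ p s) t = Φ p (s + t)) ∧ Continuous (fun q : E × ℝ => Φ q.1 q.2) := by
  choose Φ h0 hd using exists_global_solution hF hC
  refine ⟨Φ, h0, hd, fun p s t => ?_, ?_⟩
  · have h1 : ∀ t, HasDerivAt (fun t => Φ p (s + t)) (F (Φ p (s + t))) t := by
      intro t
      have h2 : HasDerivAt (fun t => s + t) 1 t := by
        simpa using (hasDerivAt_id t).const_add s
      exact ((hd p (s + t)).scomp t h2).congr_deriv (by simp)
    exact congrFun (trajectory_unique hF (hd (Φ p s)) h1 (by simp [h0])) t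
  · rw [continuous_iff_continuousAt]
    rintro ⟨p, t⟩
    rw [ContinuousAt, tendsto_iff_dist_tendsto_zero]
    have hb : ∀ q : E × ℝ, dist (Φ q.1 q.2) (Φ p t) ≤
        dist q.1 p * Real.exp (K * |q.2|) + dist (Φ p q.2) (Φ p t) := by
      intro q
      have h1 := dist_trajectories_le hF (hd q.1) (hd p) q.2
      rw [h0, h0] at h1
      exact (dist_triangle _ (Φ p q.2) _).trans (by linarith)
    refine squeeze_zero (fun _ => dist_nonneg) hb ?_
    have hc : ContinuousAt (fun q : E × ℝ =>
        dist q.1 p * Real.exp (K * |q.2|) + dist (Φ p q.2) (Φ p t)) (p, t) := by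
      refine ContinuousAt.add (by fun_prop) ?_
      have : ContinuousAt (fun q : E × ℝ => Φ p q.2) (p, t) :=
        ContinuousAt.comp (f := fun q : E × ℝ => q.2) (g := Φ p)
          ((hd p t).continuousAt) continuousAt_snd
      exact this.dist continuousAt_const
    have := hc.tendsto
    simpa using this

end Flow

/-! ### A global flow coinciding with the Lorenz flow on a box -/

theorem exists_clamp (M : ℝ) (hM : 0 ≤ M) :
    ∃ c : ℝ → ℝ, LipschitzWith 1 c ∧ (∀ x, |c x| ≤ M) ∧ ∀ x, |x| ≤ M → c x = x := by
  refine ⟨fun x => max (-M) (min x M), (LipschitzWith.id.min_const M).const_max (-M),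
    fun x => abs_le.2 ⟨le_max_left _ _, max_le (by linarith) (min_le_right _ _)⟩, fun x hx => ?_⟩
  rw [abs_le] at hx
  simp only [min_eq_left hx.2, max_eq_right hx.1]

theorem norm_triple_le_iff {p : ℝ × ℝ × ℝ} {R : ℝ} :
    ‖p‖ ≤ R ↔ |p.1| ≤ R ∧ |p.2.1| ≤ R ∧ |p.2.2| ≤ R := by
  simp only [Prod.norm_def, max_le_iff, Real.norm_eq_abs]

theorem exists_lorenz_flow (σ β M : ℝ) (hM : 0 ≤ M) :
    ∃ Φ : ℝ → ℝ × ℝ × ℝ → ℝ → ℝ × ℝ × ℝ,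
      Continuous (fun q : ℝ × (ℝ × ℝ × ℝ) × ℝ => Φ q.1 q.2.1 q.2.2) ∧
      (∀ ρ p, Φ ρ p 0 = p) ∧
      (∀ ρ p s t, Φ ρ (Φ ρ p s) t = Φ ρ p (s + t)) ∧
      (∀ ρ p t, |ρ| ≤ M → ‖Φ ρ p t‖ ≤ M →
        HasDerivAt (Φ ρ p) (lorenzRHS σ ρ β (Φ ρ p t)) t) ∧
      (∀ ρ p, |ρ| ≤ M → ‖p‖ ≤ M → lorenzRHS σ ρ β p = 0 → ∀ t, Φ ρ p t = p) := by
  obtain ⟨c, hcL, hcM, hcid⟩ := exists_clamp M hM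
  let G : ℝ × ℝ × ℝ × ℝ → ℝ × ℝ × ℝ × ℝ := fun q => (0, lorenzRHS σ q.1 β q.2)
  let π : ℝ × ℝ × ℝ × ℝ → ℝ × ℝ × ℝ × ℝ := fun q => (c q.1, c q.2.1, c q.2.2.1, c q.2.2.2)
  have hπL : LipschitzWith 1 π := by
    have h := (hcL.comp LipschitzWith.prod_fst).prodMk ((hcL.comp (LipschitzWith.prod_fst.comp
      LipschitzWith.prod_snd)).prodMk ((hcL.comp (LipschitzWith.prod_fst.comp
      (LipschitzWith.prod_snd.comp LipschitzWith.prod_snd))).prodMk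
      (hcL.comp (LipschitzWith.prod_snd.comp (LipschitzWith.prod_snd.comp
      (LipschitzWith.prod_snd (α := ℝ) (β := ℝ × ℝ × ℝ)))))))
    simpa using h
  have hπM : ∀ q, π q ∈ Metric.closedBall (0 : ℝ × ℝ × ℝ × ℝ) M := by
    intro q
    simp only [mem_closedBall_zero_iff, Prod.norm_def, max_le_iff, Real.norm_eq_abs, π]
    exact ⟨hcM _, hcM _, hcM _, hcM _⟩
  have hπid : ∀ ρ p, |ρ| ≤ M → ‖p‖ ≤ M → π (ρ, p) = (ρ, p) := by
    intro ρ p hρ hp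
    obtain ⟨h1, h2, h3⟩ := norm_triple_le_iff.1 hp
    simp only [π, hcid _ hρ, hcid _ h1, hcid _ h2, hcid _ h3]
  have hGc : ContDiff ℝ 1 G := by
    simp only [G, lorenzRHS]
    fun_prop
  obtain ⟨K, hK⟩ := (hGc.contDiffOn (s := Metric.closedBall 0 M)).exists_lipschitzOnWith
    (by norm_num) (convex_closedBall 0 M) (isCompact_closedBall 0 M)
  have hF : LipschitzWith K (G ∘ π) := by
    have h1 := hK.comp (hπL.lipschitzOnWith (s := Set.univ)) (fun q _ => hπM q)
    rw [mul_one] at h1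
    exact lipschitzOnWith_univ.1 h1
  obtain ⟨C, hC⟩ := (isCompact_closedBall (0 : ℝ × ℝ × ℝ × ℝ) M).exists_bound_of_continuousOn
    hGc.continuous.continuousOn
  obtain ⟨Ψ, h0, hd, hg, hcont⟩ := exists_flow hF (C := C) (fun q => hC _ (hπM q))
  have hρ : ∀ ρ p t, (Ψ (ρ, p) t).1 = ρ := by
    intro ρ p t
    have h1 : ∀ s, HasDerivAt (fun s => (Ψ (ρ, p) s).1) 0 s := fun s => (hd (ρ, p) s).fst
    have := is_const_of_deriv_eq_zero (fun s => (h1 s).differentiableAt)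
      (fun s => (h1 s).deriv) t 0
    rw [this, h0]
  have hpair : ∀ ρ p t, Ψ (ρ, p) t = (ρ, (Ψ (ρ, p) t).2) :=
    fun ρ p t => Prod.ext (hρ ρ p t) rfl
  refine ⟨fun ρ p t => (Ψ (ρ, p) t).2, ?_, fun ρ p => by simp only [h0], ?_, ?_, ?_⟩
  · exact continuous_snd.comp (hcont.comp (by fun_prop :
      Continuous (fun q : ℝ × (ℝ × ℝ × ℝ) × ℝ => ((q.1, q.2.1), q.2.2))))
  · intro ρ p s t
    simp only
    rw [← hpair, hg]
  · intro ρ p t h1 h2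
    have h3 := (hd (ρ, p) t).snd
    rw [Function.comp_apply, hpair, hπid _ _ h1 h2] at h3
    exact h3
  · intro ρ p h1 h2 h3 t
    have h4 : ∀ t, HasDerivAt (fun _ : ℝ => (ρ, p)) ((G ∘ π) (ρ, p)) t := by
      intro t
      rw [Function.comp_apply, hπid _ _ h1 h2]
      exact (hasDerivAt_const t (ρ, p)).congr_deriv (by simp only [G, h3]; rfl)
    have h5 := trajectory_unique hF (hd (ρ, p)) h4 (h0 _)
    simp only [h5]

/-! ### Qualitative analysis of single trajectories -/

/-- The coordinate functions `x, y, z` solve the Lorenz system at all times in `I`. -/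
structure IsLorenzSol (σ ρ β : ℝ) (x y z : ℝ → ℝ) (I : Set ℝ) : Prop where
  hx : ∀ t ∈ I, HasDerivAt x (σ * (y t - x t)) t
  hy : ∀ t ∈ I, HasDerivAt y (ρ * x t - y t - x t * z t) t
  hz : ∀ t ∈ I, HasDerivAt z (-β * z t + x t * y t) t

namespace IsLorenzSol

variable {σ ρ β : ℝ} {x y z : ℝ → ℝ} {I : Set ℝ}

theorem mono {J : Set ℝ} (h : IsLorenzSol σ ρ β x y z I) (hJ : J ⊆ I) :
    IsLorenzSol σ ρ β x y z J :=
  ⟨fun t ht => h.hx t (hJ ht), fun t ht => h.hy t (hJ ht), fun t ht => h.hz t (hJ ht)⟩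

theorem hasDerivAt_sub (h : IsLorenzSol σ ρ β x y z I) {t : ℝ} (ht : t ∈ I) :
    HasDerivAt (fun s => y s - x s) (ρ * x t - y t - x t * z t - σ * (y t - x t)) t :=
  (h.hy t ht).sub (h.hx t ht)

/-- If `x' ≥ 0` whenever `x < c`, then `x b < c` is the largest value of `x` up to time `b`. -/
theorem x_le_right (hσ : 0 < σ) {a b c : ℝ} (h : IsLorenzSol σ ρ β x y z (Set.Icc a b))
    (hab : a ≤ b) (hw : ∀ t ∈ Set.Icc a b, x t ≤ y t ∨ c ≤ x t) (hb : x b < c) : x a ≤ x b := by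
  have := le_of_deriv_nonneg_below (c := c) (m := min (x a) c) hab h.hx (fun t ht hlt => by
    rcases hw t ht with h1 | h1
    · exact mul_nonneg hσ.le (by linarith)
    · linarith) (min_le_left _ _) (min_le_right _ _)
  rcases min_le_iff.1 this with h1 | h1
  · exact h1
  · linarith

theorem x_le_left (hσ : 0 < σ) {a b c : ℝ} (h : IsLorenzSol σ ρ β x y z (Set.Icc a b))
    (hab : a ≤ b) (hw : ∀ t ∈ Set.Icc a b, y t ≤ x t ∨ c ≤ x t) (ha : x a < c) : x b ≤ x a := by
  have := le_of_deriv_nonpos_below (c := c) (m := min (x b) c) hab h.hx (fun t ht hlt => by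
    rcases hw t ht with h1 | h1
    · exact mul_nonpos_of_nonneg_of_nonpos hσ.le (by linarith)
    · linarith) (min_le_left _ _) (min_le_right _ _)
  rcases min_le_iff.1 this with h1 | h1
  · exact h1
  · linarith

theorem z_lt_sq_div (hβ : 0 < β) (h2 : β < 2 * σ) {a b : ℝ}
    (h : IsLorenzSol σ ρ β x y z (Set.Icc a b)) (hab : a ≤ b)
    (hxy : ∀ t ∈ Set.Icc a b, 0 ≤ x t ∧ x t ≤ y t) (ha : z a < x a ^ 2 / β) :
    z b < x b ^ 2 / β := by
  have := neg_of_deriv_add_nonpos (f := fun t => z t - x t ^ 2 / β)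
    (f' := fun t => -β * z t + x t * y t - 2 * x t * (σ * (y t - x t)) / β) β hab
    (fun t ht => ((h.hz t ht).sub (((h.hx t ht).pow 2).div_const β)).congr_deriv (by
      simp)) ?_ (by linarith)
  · linarith
  · intro t ht
    obtain ⟨h3, h4⟩ := hxy t ⟨ht.1.le, ht.2.le⟩
    have : -β * z t + x t * y t - 2 * x t * (σ * (y t - x t)) / β + β * (z t - x t ^ 2 / β)
        = -(x t * (y t - x t) * (2 * σ - β) / β) := by
      field_simp
      ring
    rw [this]
    have : 0 ≤ x t * (y t - x t) * (2 * σ - β) / β :=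
      div_nonneg (mul_nonneg (mul_nonneg h3 (by linarith)) (by linarith)) hβ.le
    linarith

theorem eventually_pos_left_of_second_deriv {f f' : ℝ → ℝ} {f'' a τ : ℝ} (haτ : a < τ)
    (hf : ∀ t ∈ Set.Icc a τ, HasDerivAt f (f' t) t) (hf' : HasDerivAt f' f'' τ)
    (h2 : 0 < f'') (h1 : f' τ = 0) (h0 : f τ = 0) : ∀ᶠ t in 𝓝[<] τ, 0 < f t := by
  obtain ⟨l, hl, hl'⟩ := (mem_nhdsLT_iff_exists_Ioo_subset).1
    (eventually_sign_of_deriv_pos hf' h2 h1).1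
  have hmax : max a l < τ := max_lt haτ hl
  filter_upwards [Ioo_mem_nhdsLT hmax] with t ht
  have hat : a < t := (le_max_left _ _).trans_lt ht.1
  have hlt : l < t := (le_max_right _ _).trans_lt ht.1
  have := mul_exp_lt_of_deriv_add_pos (f := fun t => -f t) (f' := fun t => -f' t) 0 ht.2
    (fun s hs => (hf s ⟨hat.le.trans hs.1, hs.2⟩).neg)
    (fun s hs => by
      have : f' s < 0 := hl' ⟨hlt.trans hs.1, hs.2⟩
      simpa using this)
  simpa [h0] using this

/-- A trajectory starting from `x < c` cannot be tangent from the inside to the plane `x = c`,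
where `c` is the abscissa of an equilibrium. -/
theorem not_tangent (hσ : 0 < σ) (hβ : 0 < β) (hσβ : 2 * β + 1 < 3 * σ) {c : ℝ} (hc : 0 < c)
    (hc2 : c ^ 2 = β * (ρ - 1)) {t : ℝ} (ht : 0 < t)
    (h : IsLorenzSol σ ρ β x y z (Set.Icc 0 t)) (h0 : x 0 < c) (hxt : x t = c) (hyt : y t = c)
    (hzt : z t < ρ - 1) : False := by
  have htm : t ∈ Set.Icc 0 t := ⟨ht.le, le_rfl⟩
  have hcont : ContinuousOn x (Set.Icc 0 t) :=
    fun s hs => (h.hx s hs).continuousAt.continuousWithinAt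
  obtain ⟨l, hl, hl'⟩ := (mem_nhdsLT_iff_exists_Ioo_subset).1
    (eventually_sign_of_deriv_pos (h.hasDerivAt_sub htm)
      (by rw [hxt, hyt]; nlinarith) (by rw [hxt, hyt, sub_self])).1
  obtain ⟨a, ha1, ha2⟩ := exists_between (max_lt ht hl)
  have ha0 : 0 < a := (le_max_left _ _).trans_lt ha1
  have hla : l < a := (le_max_right _ _).trans_lt ha1
  have hgt : ∀ s, a ≤ s → s < t → c < x s := by
    intro s has hst
    have := mul_exp_lt_of_deriv_add_pos (f := fun t => -x t) (f' := fun s => -(σ * (y s - x s)))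
      0 hst (fun r hr => (h.hx r ⟨by linarith [hr.1], hr.2⟩).neg)
      (fun r hr => by
        have : y r - x r < 0 := hl' ⟨by linarith [hr.1], hr.2⟩
        nlinarith)
    simp [hxt] at this
    exact this
  obtain ⟨u, hu0, hua, hxu, hu⟩ := exists_last_eq (f := fun t => -x t) (m := -c) ha0.le
    (hcont.mono (Set.Icc_subset_Icc_right ha2.le)).neg (by linarith)
    (by have := hgt a le_rfl ha2; linarith)
  have hxu : x u = c := by linarith
  have hut : u < t := hua.trans ha2
  have hgt' : ∀ s, u < s → s < t → c < x s := by
    intro s h1 h2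
    rcases le_total a s with h3 | h3
    · exact hgt s h3 h2
    · linarith [hu s h1 h3]
  have hsub : ∀ s ∈ Set.Icc u t, s ∈ Set.Icc 0 t := fun s hs => ⟨hu0.trans hs.1, hs.2⟩
  have hpos : ∀ s ∈ Set.Icc u t, 0 < x s := by
    intro s hs
    rcases eq_or_lt_of_le hs.1 with h1 | h1
    · rw [← h1, hxu]; exact hc
    · rcases eq_or_lt_of_le hs.2 with h2 | h2
      · rw [h2, hxt]; exact hc
      · exact hc.trans (hgt' s h1 h2)
  set e : ℝ → ℝ := fun s => σ * (ρ - 1 - z s) + (x s ^ 2 - c ^ 2) / 2 with he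
  have hed : ∀ s ∈ Set.Icc u t,
      HasDerivAt e (-β * e s - (σ - β / 2) * (x s ^ 2 - c ^ 2)) s := by
    intro s hs
    refine ((((hasDerivAt_const s (ρ - 1)).sub (h.hz s (hsub s hs))).const_mul σ).add
      ((((h.hx s (hsub s hs)).pow 2).sub_const (c ^ 2)).div_const 2)).congr_deriv ?_
    simp only [he]
    push_cast
    linear_combination (-σ) * hc2
  have hepos : ∀ s ∈ Set.Icc u t, 0 < e s := by
    intro s hs
    by_contra hcon
    have h1 := nonpos_of_deriv_add_nonpos β hs.2
      (fun r hr => hed r ⟨hs.1.trans hr.1, hr.2⟩) (fun r hr => by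
        have h2 := hgt' r (hs.1.trans_lt hr.1) hr.2
        have h3 : 0 < x r ^ 2 - c ^ 2 := by nlinarith
        have h4 : 0 < σ - β / 2 := by linarith
        nlinarith [mul_pos h4 h3]) (not_lt.1 hcon)
    simp only [he, hxt, sub_self, zero_div, add_zero] at h1
    nlinarith
  set Q : ℝ → ℝ := fun s => (σ * (y s - x s)) ^ 2 + (x s ^ 2 - c ^ 2) ^ 2 / 4
    - e s * (x s ^ 2 - c ^ 2) + (σ + 1) * ((x s ^ 2 - c ^ 2) * (σ * (y s - x s)) / x s) with hQ
  set Q' : ℝ → ℝ := fun s => -(σ + 1) * Q s + (σ + 1) * c ^ 2 * (σ * (y s - x s) / x s) ^ 2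
    + β * e s * (x s ^ 2 - c ^ 2) + (3 * σ - 1 - 2 * β) * (x s ^ 2 - c ^ 2) ^ 2 / 4 with hQ'
  have hQd : ∀ s ∈ Set.Icc u t, HasDerivAt Q (Q' s) s := by
    intro s hs
    have hx := h.hx s (hsub s hs)
    have hp := (h.hasDerivAt_sub (hsub s hs)).const_mul σ
    have hs2 := (hx.pow 2).sub_const (c ^ 2)
    have hne := (hpos s hs).ne'
    refine ((((hp.pow 2).add ((hs2.pow 2).div_const 4)).sub ((hed s hs).mul hs2)).add
      (((hs2.mul hp).div hx hne).const_mul (σ + 1))).congr_deriv ?_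
    simp only [hQ', hQ, he, Pi.mul_apply, Pi.pow_apply, Nat.cast_ofNat]
    field_simp
    ring
  have hlt := mul_exp_lt_of_deriv_add_pos (σ + 1) hut hQd (fun s hs => by
    have h1 := hgt' s hs.1 hs.2
    have h3 : 0 < x s ^ 2 - c ^ 2 := by nlinarith
    have h4 := hepos s ⟨hs.1.le, hs.2.le⟩
    have h5 : 0 < 3 * σ - 1 - 2 * β := by linarith
    have h6 : 0 ≤ (σ + 1) * c ^ 2 * (σ * (y s - x s) / x s) ^ 2 := by positivity
    have h7 : 0 < β * e s * (x s ^ 2 - c ^ 2) := by positivity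
    have h8 : 0 < (3 * σ - 1 - 2 * β) * (x s ^ 2 - c ^ 2) ^ 2 / 4 := by positivity
    simp only [hQ']
    linarith)
  have hQt : Q t = 0 := by simp [hQ, hxt, hyt]
  have hQu : 0 ≤ Q u := by simp [hQ, hxu]; positivity
  rw [hQt, zero_mul] at hlt
  have := mul_nonneg hQu (Real.exp_pos ((σ + 1) * u)).le
  linarith

theorem eq_zero_of_xy_eq_zero (hσ : 0 < σ) {t : ℝ} (ht : 0 ≤ t)
    (h : IsLorenzSol σ ρ β x y z (Set.Icc 0 t)) (hx : x t = 0) (hy : y t = 0) : x 0 = 0 := by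
  obtain ⟨Z, hZ⟩ := isCompact_Icc.exists_bound_of_continuousOn (s := Set.Icc 0 t) (f := z)
    (fun s hs => (h.hz s hs).continuousAt.continuousWithinAt)
  have hZ : ∀ s ∈ Set.Icc 0 t, |z s| ≤ Z := hZ
  have hd : ∀ s ∈ Set.Icc 0 t, HasDerivAt (fun s => x s ^ 2 + y s ^ 2)
      (2 * x s * (σ * (y s - x s)) + 2 * y s * (ρ * x s - y s - x s * z s)) s := fun s hs =>
    (((h.hx s hs).pow 2).add ((h.hy s hs).pow 2)).congr_deriv (by simp)
  have := mul_exp_le_of_deriv_add_nonneg (2 * σ + 2 + |σ + ρ| + Z) ht hd (fun s hs => by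
    have h1 := hZ s ⟨hs.1.le, hs.2.le⟩
    have h2 : 2 * |x s * y s| ≤ x s ^ 2 + y s ^ 2 := by
      rw [abs_mul]
      nlinarith [sq_nonneg (|x s| - |y s|), sq_abs (x s), sq_abs (y s)]
    have h3 : |σ + ρ - z s| ≤ |σ + ρ| + Z := (abs_sub _ _).trans (by linarith)
    have h4 : -((|σ + ρ| + Z) * (x s ^ 2 + y s ^ 2)) ≤ 2 * (x s * y s) * (σ + ρ - z s) := by
      refine neg_le_of_abs_le ?_
      rw [abs_mul, abs_mul, abs_two, mul_comm]
      exact mul_le_mul h3 h2 (by positivity) ((abs_nonneg _).trans h3)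
    nlinarith [sq_nonneg (x s), sq_nonneg (y s), mul_nonneg hσ.le (sq_nonneg (y s))])
  rw [hx, hy] at this
  simp only [mul_zero, Real.exp_zero, mul_one] at this
  have h5 : x 0 ^ 2 = 0 := by nlinarith [sq_nonneg (x 0), sq_nonneg (y 0)]
  exact pow_eq_zero_iff two_ne_zero |>.1 h5

theorem eq_equilibrium (hσ : 0 < σ) (hβ : 0 < β) {c : ℝ} (hc : 0 ≤ c)
    (hc2 : c ^ 2 = β * (ρ - 1)) {t : ℝ} (ht : 0 ≤ t)
    (h : IsLorenzSol σ ρ β x y z (Set.Icc 0 t)) (hx : x t = c) (hy : y t = c)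
    (hz : z t = ρ - 1) : x 0 = c := by
  have hd : ∀ s ∈ Set.Icc 0 t,
      HasDerivAt (fun s => (x s - c) ^ 2 + (y s - c) ^ 2 + (z s - (ρ - 1)) ^ 2)
      (2 * (x s - c) * (σ * (y s - x s)) + 2 * (y s - c) * (ρ * x s - y s - x s * z s)
        + 2 * (z s - (ρ - 1)) * (-β * z s + x s * y s)) s := fun s hs =>
    (((((h.hx s hs).sub_const c).pow 2).add (((h.hy s hs).sub_const c).pow 2)).add
      (((h.hz s hs).sub_const (ρ - 1)).pow 2)).congr_deriv (by simp)
  have := mul_exp_le_of_deriv_add_nonneg (3 * (σ + 1) + c + 2 * β) ht hd (fun s hs => by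
    set u := x s - c with hu
    set v := y s - c with hv
    set w := z s - (ρ - 1) with hw
    have hx' : x s = u + c := by rw [hu]; ring
    have hy' : y s = v + c := by rw [hv]; ring
    have hz' : z s = w + (ρ - 1) := by rw [hw]; ring
    have h1 : 2 * u * (σ * (y s - x s)) + 2 * v * (ρ * x s - y s - x s * z s)
        + 2 * w * (-β * z s + x s * y s) =
        -2 * σ * u ^ 2 - 2 * v ^ 2 - 2 * β * w ^ 2 + 2 * (σ + 1) * (u * v) + 2 * c * (u * w) := by
      rw [hx', hy', hz']
      linear_combination (2 * w) * hc2
    rw [h1]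
    nlinarith [mul_nonneg (by linarith : 0 ≤ σ + 1) (sq_nonneg (u + v)),
      mul_nonneg hc (sq_nonneg (u + w)), mul_nonneg hc (sq_nonneg v),
      mul_nonneg hβ.le (sq_nonneg u),
      mul_nonneg hβ.le (sq_nonneg v), mul_nonneg hσ.le (sq_nonneg u),
      mul_nonneg hσ.le (sq_nonneg v), mul_nonneg hσ.le (sq_nonneg w),
      sq_nonneg u, sq_nonneg v, sq_nonneg w])
  rw [hx, hy, hz] at this
  simp only [mul_zero, Real.exp_zero, mul_one] at this
  have h5 : (x 0 - c) ^ 2 = 0 := by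
    nlinarith [sq_nonneg (x 0 - c), sq_nonneg (y 0 - c), sq_nonneg (z 0 - (ρ - 1))]
  linarith [pow_eq_zero_iff two_ne_zero |>.1 h5]

end IsLorenzSol

/-- Until `t₁` the trajectory rises as long as `x ≤ c`, from `t₁` to `T` it descends as long as
`x ≤ c`, and it has reached negative values of `x` at time `T`. -/
structure IsDescent (c : ℝ) (x y : ℝ → ℝ) (t₁ T : ℝ) : Prop where
  nonneg : 0 ≤ t₁
  le : t₁ ≤ T
  up : ∀ t ∈ Set.Icc 0 t₁, x t < y t ∨ c < x t
  down : ∀ t ∈ Set.Icc t₁ T, y t < x t ∨ c < x t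
  neg : x T < 0

/-- The closed counterpart of `IsDescent`. -/
structure IsWeakDescent (c : ℝ) (x y : ℝ → ℝ) (t₁ T : ℝ) : Prop where
  nonneg : 0 ≤ t₁
  le : t₁ ≤ T
  up : ∀ t ∈ Set.Icc 0 t₁, x t ≤ y t ∨ c ≤ x t
  down : ∀ t ∈ Set.Icc t₁ T, y t ≤ x t ∨ c ≤ x t
  nonpos : x T ≤ 0

theorem IsDescent.weak {c : ℝ} {x y : ℝ → ℝ} {t₁ T : ℝ} (h : IsDescent c x y t₁ T) :
    IsWeakDescent c x y t₁ T :=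
  ⟨h.nonneg, h.le, fun t ht => (h.up t ht).imp le_of_lt le_of_lt,
    fun t ht => (h.down t ht).imp le_of_lt le_of_lt, h.neg.le⟩

namespace IsLorenzSol

variable {σ ρ β c : ℝ} {x y z : ℝ → ℝ}

theorem z_lt_of_up (hσ : 0 < σ) (hβ : 0 < β) (h2 : β < 2 * σ) (hc : 0 < c)
    (hc2 : c ^ 2 = β * (ρ - 1)) {τ : ℝ} (hτ : 0 ≤ τ)
    (h : IsLorenzSol σ ρ β x y z (Set.Icc 0 τ))
    (h0 : 0 < x 0) (hz0 : z 0 < x 0 ^ 2 / β)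
    (hup : ∀ t ∈ Set.Icc 0 τ, x t ≤ y t ∨ c ≤ x t) (hxτ : x τ < c) :
    0 < x τ ∧ z τ < ρ - 1 := by
  have hle : ∀ s ∈ Set.Icc 0 τ, x s ≤ x τ := fun s hs =>
    (h.mono (Set.Icc_subset_Icc_left hs.1)).x_le_right hσ hs.2
      (fun t ht => hup t ⟨hs.1.trans ht.1, ht.2⟩) hxτ
  have hge : ∀ s ∈ Set.Icc 0 τ, x 0 ≤ x s := fun s hs =>
    (h.mono (Set.Icc_subset_Icc_right hs.2)).x_le_right hσ hs.1
      (fun t ht => hup t ⟨ht.1, ht.2.trans hs.2⟩) ((hle s hs).trans_lt hxτ)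
  have hxp : 0 < x τ := h0.trans_le (hge τ ⟨hτ, le_rfl⟩)
  refine ⟨hxp, ?_⟩
  have h3 := h.z_lt_sq_div hβ h2 hτ (fun s hs => ⟨(h0.trans_le (hge s hs)).le,
    (hup s hs).resolve_right (by linarith [hle s hs])⟩) hz0
  refine h3.trans ?_
  rw [div_lt_iff₀ hβ]
  nlinarith

theorem lt_of_up (hσ : 0 < σ) (hβ : 0 < β) (h2 : β < 2 * σ) (hc : 0 < c)
    (hc2 : c ^ 2 = β * (ρ - 1)) {τ : ℝ} (hτ : 0 ≤ τ)
    (h : IsLorenzSol σ ρ β x y z (Set.Icc 0 τ))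
    (h0 : 0 < x 0) (hy0 : x 0 < y 0) (hz0 : z 0 < x 0 ^ 2 / β)
    (hup : ∀ t ∈ Set.Icc 0 τ, x t ≤ y t ∨ c ≤ x t) (hxτ : x τ < c) : x τ < y τ := by
  by_contra hcon
  have hτm : τ ∈ Set.Icc 0 τ := ⟨hτ, le_rfl⟩
  have heq : y τ = x τ :=
    le_antisymm (not_lt.1 hcon) ((hup τ hτm).resolve_right (by linarith))
  have hτ0 : 0 < τ := lt_of_le_of_ne hτ (by rintro rfl; linarith)
  obtain ⟨hxp, hzlt⟩ := h.z_lt_of_up hσ hβ h2 hc hc2 hτ h0 hz0 hup hxτ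
  have hev := (eventually_sign_of_deriv_pos (h.hasDerivAt_sub hτm)
    (by rw [heq]; nlinarith) (by rw [heq, sub_self])).1
  have hev2 : ∀ᶠ t in 𝓝[<] τ, x t < c :=
    nhdsWithin_le_nhds ((h.hx τ hτm).continuousAt.eventually_lt continuousAt_const hxτ)
  obtain ⟨t, ⟨h3, h4⟩, h5⟩ := ((hev.and hev2).and (Ioo_mem_nhdsLT hτ0)).exists
  rcases hup t ⟨h5.1.le, h5.2.le⟩ with h6 | h6 <;> linarith

theorem lt_of_down (hc : 0 < c) (hc2 : c ^ 2 = β * (ρ - 1)) {t₁ S τ : ℝ} (h1 : t₁ < τ) (hS : τ < S)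
    (h : IsLorenzSol σ ρ β x y z (Set.Icc t₁ S))
    (hdown : ∀ t ∈ Set.Icc t₁ S, y t ≤ x t ∨ c ≤ x t) (hxp : 0 < x τ) (hxτ : x τ < c) :
    y τ < x τ := by
  by_contra hcon
  have hτm : τ ∈ Set.Icc t₁ S := ⟨h1.le, hS.le⟩
  have heq : y τ = x τ :=
    le_antisymm ((hdown τ hτm).resolve_right (by linarith)) (not_lt.1 hcon)
  have hev := (h.hx τ hτm).continuousAt.eventually_lt continuousAt_const hxτ
  have hleft : ¬ ∀ᶠ t in 𝓝[<] τ, 0 < y t - x t := by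
    intro h3
    obtain ⟨t, ⟨h3, h4⟩, h5⟩ :=
      ((h3.and (nhdsWithin_le_nhds hev)).and (Ioo_mem_nhdsLT h1)).exists
    rcases hdown t ⟨h5.1.le, (h5.2.trans hS).le⟩ with h6 | h6 <;> linarith
  have hD := h.hasDerivAt_sub hτm
  have hD0 : y τ - x τ = 0 := by rw [heq, sub_self]
  rcases lt_trichotomy (z τ) (ρ - 1) with h3 | h3 | h3
  · have hev2 := (eventually_sign_of_deriv_pos hD (by rw [heq]; nlinarith) hD0).2
    obtain ⟨t, ⟨h3, h4⟩, h5⟩ :=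
      ((hev2.and (nhdsWithin_le_nhds hev)).and (Ioo_mem_nhdsGT hS)).exists
    rcases hdown t ⟨(h1.trans h5.1).le, h5.2.le⟩ with h6 | h6 <;> linarith
  · refine hleft (eventually_pos_left_of_second_deriv h1
      (fun s hs => h.hasDerivAt_sub ⟨hs.1, hs.2.trans hS.le⟩)
      (((((h.hx τ hτm).const_mul ρ).sub (h.hy τ hτm)).sub ((h.hx τ hτm).mul (h.hz τ hτm))).sub
        (hD.const_mul σ)) ?_ ?_ hD0)
    · have : ρ * (σ * (y τ - x τ)) - (ρ * x τ - y τ - x τ * z τ) -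
          (σ * (y τ - x τ) * z τ + x τ * (-β * z τ + x τ * y τ)) -
          σ * (ρ * x τ - y τ - x τ * z τ - σ * (y τ - x τ)) = x τ * (c ^ 2 - x τ ^ 2) := by
        rw [heq, h3, hc2]; ring
      rw [this]
      exact mul_pos hxp (by nlinarith)
    · rw [heq, h3]; ring
  · exact hleft (eventually_sign_of_deriv_neg hD (by rw [heq]; nlinarith) hD0).1

/-- A weak descent of a trajectory starting near the origin is, up to changing the times,
a strict descent. -/
theorem exists_isDescent (hσ : 0 < σ) (hβ : 0 < β) (hσβ : 2 * β + 1 < 3 * σ) (hc : 0 < c)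
    (hc2 : c ^ 2 = β * (ρ - 1)) (h : IsLorenzSol σ ρ β x y z (Set.Ici 0))
    (h0 : 0 < x 0) (h0c : x 0 < c) (hy0 : x 0 < y 0) (hz0 : z 0 < x 0 ^ 2 / β)
    {t₁ T : ℝ} (hw : IsWeakDescent c x y t₁ T) : ∃ t₁ T, IsDescent c x y t₁ T := by
  have h2 : β < 2 * σ := by linarith
  obtain ⟨ht1, ht1T, hup, hdown, hT⟩ := hw
  have hT0 : 0 ≤ T := ht1.trans ht1T
  have hsub : ∀ a b, 0 ≤ a → IsLorenzSol σ ρ β x y z (Set.Icc a b) := fun a b ha =>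
    h.mono (fun t ht => ha.trans ht.1)
  have hcx : ∀ t, 0 ≤ t → ContinuousAt x t := fun t ht => (h.hx t ht).continuousAt
  have hcD : ∀ t, 0 ≤ t → ContinuousAt (fun s => y s - x s) t :=
    fun t ht => (h.hasDerivAt_sub ht).continuousAt
  obtain ⟨S, hS0, hST, hxS, hSpos⟩ := exists_first_eq (f := fun t => -x t) (m := 0) hT0
    (fun t ht => ((hcx t ht.1).continuousWithinAt).neg) (by linarith) (by linarith)
  have hxS : x S = 0 := by linarith
  have hSpos : ∀ t, 0 ≤ t → t < S → 0 < x t := fun t h3 h4 => by linarith [hSpos t h3 h4]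
  have ht1S : t₁ < S := by
    by_contra hcon
    have := (hsub 0 S le_rfl).x_le_right hσ hS0.le
      (fun t ht => hup t ⟨ht.1, ht.2.trans (not_lt.1 hcon)⟩) (by linarith)
    linarith
  have hyS : y S < 0 := by
    rcases lt_or_eq_of_le ((hdown S ⟨ht1S.le, hST⟩).resolve_right (by linarith)) with h3 | h3
    · linarith
    · have := (hsub 0 S le_rfl).eq_zero_of_xy_eq_zero hσ hS0.le hxS (by linarith)
      linarith
  have up1 : ∀ τ, 0 ≤ τ → τ ≤ t₁ → x τ < c → x τ < y τ := fun τ h3 h4 h5 =>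
    (hsub 0 τ le_rfl).lt_of_up hσ hβ h2 hc hc2 h3 h0 hy0 hz0
      (fun t ht => hup t ⟨ht.1, ht.2.trans h4⟩) h5
  have down1 : ∀ τ, t₁ < τ → τ ≤ S → x τ < c → y τ < x τ := by
    intro τ h3 h4 h5
    rcases eq_or_lt_of_le h4 with h6 | h6
    · rw [h6, hxS]; exact hyS
    · exact (hsub t₁ S ht1).lt_of_down hc hc2 h3 h6
        (fun t ht => hdown t ⟨ht.1, ht.2.trans hST⟩) (hSpos τ (by linarith) h6) h5
  have right_lt : ∀ τ, 0 ≤ τ → x τ = c → y τ < x τ → ∀ᶠ t in 𝓝[>] τ, x t < c := by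
    intro τ h3 h4 h5
    have h6 := (eventually_sign_of_deriv_neg ((h.hx τ h3).sub_const c) (by nlinarith)
      (by rw [h4, sub_self])).2
    filter_upwards [h6] with t ht using by linarith
  have right_gt : ∀ τ, 0 ≤ τ → x τ = c → x τ < y τ → ∀ᶠ t in 𝓝[>] τ, c < x t := by
    intro τ h3 h4 h5
    have h6 := (eventually_sign_of_deriv_pos ((h.hx τ h3).sub_const c) (by nlinarith)
      (by rw [h4, sub_self])).2
    filter_upwards [h6] with t ht using by linarith
  have left_lt : ∀ τ, 0 ≤ τ → x τ = c → x τ < y τ → ∀ᶠ t in 𝓝[<] τ, x t < c := by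
    intro τ h3 h4 h5
    have h6 := (eventually_sign_of_deriv_pos ((h.hx τ h3).sub_const c) (by nlinarith)
      (by rw [h4, sub_self])).1
    filter_upwards [h6] with t ht using by linarith
  have left_gt : ∀ τ, 0 ≤ τ → x τ = c → y τ < x τ → ∀ᶠ t in 𝓝[<] τ, c < x t := by
    intro τ h3 h4 h5
    have h6 := (eventually_sign_of_deriv_neg ((h.hx τ h3).sub_const c) (by nlinarith)
      (by rw [h4, sub_self])).1
    filter_upwards [h6] with t ht using by linarith
  have noteq : ∀ τ, 0 ≤ τ → τ ≤ S → x τ = c → y τ ≠ x τ := by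
    intro τ h3 h4 h5 h6
    have hτ0 : 0 < τ := lt_of_le_of_ne h3 (by rintro rfl; linarith)
    have hτS : τ < S := lt_of_le_of_ne h4 (by rintro rfl; linarith)
    rcases lt_trichotomy (z τ) (ρ - 1) with h7 | h7 | h7
    · exact (hsub 0 τ le_rfl).not_tangent hσ hβ hσβ hc hc2 hτ0 h0c h5 (h6.trans h5) h7
    · have := (hsub 0 τ le_rfl).eq_equilibrium hσ hβ hc.le hc2 h3 h5 (h6.trans h5) h7
      linarith
    · obtain ⟨hl, hr⟩ := eventually_sign_of_deriv_neg (h.hasDerivAt_sub h3)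
        (by rw [h6, h5]; nlinarith) (by rw [h6, sub_self])
      have hleft : ∀ᶠ t in 𝓝[<] τ, x t < c := by
        obtain ⟨l, hl1, hl2⟩ := (mem_nhdsLT_iff_exists_Ioo_subset).1 hl
        filter_upwards [Ioo_mem_nhdsLT (max_lt hτ0 hl1)] with t ht
        have ht0 : 0 < t := (le_max_left _ _).trans_lt ht.1
        have := mul_exp_lt_of_deriv_add_pos 0 ht.2 (fun s hs => h.hx s (ht0.le.trans hs.1))
          (fun s hs => by
            have h8 : 0 < y s - x s := hl2 ⟨(le_max_right _ _).trans_lt (ht.1.trans hs.1), hs.2⟩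
            rw [zero_mul, add_zero]
            exact mul_pos hσ h8)
        simpa [h5] using this
      rcases lt_trichotomy τ t₁ with h8 | h8 | h8
      · obtain ⟨r, hr1, hr2⟩ := (mem_nhdsGT_iff_exists_Ioo_subset).1 hr
        obtain ⟨t, ht1, ht2⟩ := exists_between (lt_min hr1 h8)
        have htr : t < r := ht2.trans_le (min_le_left _ _)
        have htt : t < t₁ := ht2.trans_le (min_le_right _ _)
        have := mul_exp_lt_of_deriv_add_pos 0 ht1
          (fun s hs => (h.hx s (h3.trans hs.1)).neg)
          (fun s hs => by
            have h9 : y s - x s < 0 := hr2 ⟨hs.1, hs.2.trans htr⟩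
            simp only [zero_mul, add_zero]
            nlinarith)
        have h10 : y t - x t < 0 := hr2 ⟨ht1, htr⟩
        simp [h5] at this
        rcases hup t ⟨by linarith, htt.le⟩ with h9 | h9 <;> linarith
      · have hz : ∀ᶠ t in 𝓝[<] τ, ρ - 1 < z t :=
          nhdsWithin_le_nhds (continuousAt_const.eventually_lt (h.hz τ h3).continuousAt h7)
        obtain ⟨t, ⟨h9, h10⟩, h11⟩ := ((hz.and hleft).and (Ioo_mem_nhdsLT hτ0)).exists
        have := ((hsub 0 t le_rfl).z_lt_of_up hσ hβ h2 hc hc2 h11.1.le h0 hz0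
          (fun s hs => hup s ⟨hs.1, by linarith [hs.2, h11.2]⟩) h10).2
        linarith
      · obtain ⟨t, ⟨h9, h10⟩, h11⟩ := ((hl.and hleft).and (Ioo_mem_nhdsLT h8)).exists
        rcases hdown t ⟨h11.1.le, by linarith [h11.2]⟩ with h12 | h12 <;> linarith
  have up2 : ∀ τ, 0 ≤ τ → τ < t₁ → x τ < y τ ∨ c < x τ := by
    intro τ h3 h4
    rcases lt_trichotomy (x τ) c with h5 | h5 | h5
    · exact Or.inl (up1 τ h3 h4.le h5)
    · rcases lt_trichotomy (x τ) (y τ) with h6 | h6 | h6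
      · exact Or.inl h6
      · exact absurd h6.symm (noteq τ h3 (by linarith) h5)
      · have hD : ∀ᶠ t in 𝓝[>] τ, y t - x t < 0 :=
          nhdsWithin_le_nhds ((hcD τ h3).eventually_lt continuousAt_const (by linarith))
        obtain ⟨t, ⟨h9, h10⟩, h11⟩ :=
          (((right_lt τ h3 h5 h6).and hD).and (Ioo_mem_nhdsGT h4)).exists
        rcases hup t ⟨by linarith [h11.1], h11.2.le⟩ with h12 | h12 <;> linarith
    · exact Or.inr h5
  have down2 : ∀ τ, t₁ < τ → τ ≤ S → y τ < x τ ∨ c < x τ := by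
    intro τ h3 h4
    have h3' : 0 ≤ τ := by linarith
    rcases lt_trichotomy (x τ) c with h5 | h5 | h5
    · exact Or.inl (down1 τ h3 h4 h5)
    · rcases lt_trichotomy (x τ) (y τ) with h6 | h6 | h6
      · have hD : ∀ᶠ t in 𝓝[<] τ, 0 < y t - x t :=
          nhdsWithin_le_nhds (continuousAt_const.eventually_lt (hcD τ h3') (by linarith))
        obtain ⟨t, ⟨h9, h10⟩, h11⟩ :=
          (((left_lt τ h3' h5 h6).and hD).and (Ioo_mem_nhdsLT h3)).exists
        rcases hdown t ⟨h11.1.le, by linarith [h11.2]⟩ with h12 | h12 <;> linarith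
      · exact absurd h6.symm (noteq τ h3' h4 h5)
      · exact Or.inl h6
    · exact Or.inr h5
  obtain ⟨U, hSU, hU1, hU2⟩ : ∃ U, S < U ∧ x U < 0 ∧ ∀ t, S ≤ t → t ≤ U → y t < x t := by
    have hD : ∀ᶠ t in 𝓝[>] S, y t - x t < 0 :=
      nhdsWithin_le_nhds ((hcD S hS0.le).eventually_lt continuousAt_const (by linarith))
    have hx := (eventually_sign_of_deriv_neg (h.hx S hS0.le) (by rw [hxS]; nlinarith) hxS).2
    obtain ⟨r, hr1, hr2⟩ := (mem_nhdsGT_iff_exists_Ioo_subset).1 (hD.and hx)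
    obtain ⟨U, hU1, hU2⟩ := exists_between (show S < r from hr1)
    refine ⟨U, hU1, (hr2 ⟨hU1, hU2⟩).2, fun t h3 h4 => ?_⟩
    rcases eq_or_lt_of_le h3 with h5 | h5
    · rw [← h5]; linarith
    · have : y t - x t < 0 := (hr2 ⟨h5, h4.trans_lt hU2⟩).1
      linarith
  have down3 : ∀ τ, t₁ < τ → τ ≤ U → y τ < x τ ∨ c < x τ := by
    intro τ h3 h4
    rcases le_total τ S with h5 | h5
    · exact down2 τ h3 h5
    · exact Or.inl (hU2 τ h5 h4)
  rcases lt_trichotomy (x t₁) c with h3 | h3 | h3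
  · have := up1 t₁ ht1 le_rfl h3
    rcases hdown t₁ ⟨le_rfl, ht1T⟩ with h12 | h12 <;> linarith
  · rcases lt_trichotomy (x t₁) (y t₁) with h4 | h4 | h4
    · obtain ⟨r, hr1, hr2⟩ := (mem_nhdsGT_iff_exists_Ioo_subset).1 (right_gt t₁ ht1 h3 h4)
      obtain ⟨s, hs1, hs2⟩ := exists_between (lt_min hr1 ht1S)
      have hsr : s < r := hs2.trans_le (min_le_left _ _)
      have hss : s < S := hs2.trans_le (min_le_right _ _)
      refine ⟨s, U, by linarith, by linarith, fun t ht => ?_,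
        fun t ht => down3 t (hs1.trans_le ht.1) ht.2, hU1⟩
      rcases lt_trichotomy t t₁ with h5 | h5 | h5
      · exact up2 t ht.1 h5
      · rw [h5]; exact Or.inl h4
      · exact Or.inr (hr2 ⟨h5, ht.2.trans_lt hsr⟩)
    · exact absurd h4.symm (noteq t₁ ht1 ht1S.le h3)
    · have ht0 : 0 < t₁ := lt_of_le_of_ne ht1 (by rintro rfl; linarith)
      obtain ⟨l, hl1, hl2⟩ := (mem_nhdsLT_iff_exists_Ioo_subset).1 (left_gt t₁ ht1 h3 h4)
      obtain ⟨s, hs1, hs2⟩ := exists_between (max_lt hl1 ht0)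
      have hsl : l < s := (le_max_left _ _).trans_lt hs1
      have hs0 : 0 < s := (le_max_right _ _).trans_lt hs1
      refine ⟨s, U, hs0.le, by linarith, fun t ht => up2 t ht.1 (ht.2.trans_lt hs2),
        fun t ht => ?_, hU1⟩
      rcases lt_trichotomy t t₁ with h5 | h5 | h5
      · exact Or.inr (hl2 ⟨hsl.trans_le ht.1, h5⟩)
      · rw [h5]; exact Or.inl h4
      · exact down3 t h5 ht.2
  · refine ⟨t₁, U, ht1, by linarith, fun t ht => ?_, fun t ht => ?_, hU1⟩
    · rcases eq_or_lt_of_le ht.2 with h5 | h5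
      · rw [h5]; exact Or.inr h3
      · exact up2 t ht.1 h5
    · rcases eq_or_lt_of_le ht.1 with h5 | h5
      · rw [← h5]; exact Or.inr h3
      · exact down3 t h5 ht.2

end IsLorenzSol

namespace IsLorenzSol

variable {σ ρ β : ℝ} {x y z : ℝ → ℝ}

theorem trapping (hβ : 0 < β) {m L S : ℝ} (hm : 0 < m) (hmσ : m ≤ 2 * σ)
    (hm2 : m ≤ 2) (hmβ : m ≤ β) (hL : 1 + β / m ≤ L) (hS : 0 ≤ S)
    (h : IsLorenzSol σ ρ β x y z (Set.Icc 0 S))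
    (h0 : x 0 ^ 2 + y 0 ^ 2 + (z 0 - (σ + ρ)) ^ 2 ≤ (L * (σ + ρ)) ^ 2) :
    x S ^ 2 + y S ^ 2 + (z S - (σ + ρ)) ^ 2 ≤ (L * (σ + ρ)) ^ 2 := by
  have hβm : 0 < β / m := div_pos hβ hm
  have hL2 : β ≤ m * L ^ 2 := by
    have h1 : β / m ≤ L ^ 2 := by nlinarith
    rwa [div_le_iff₀ hm, mul_comm] at h1
  have hd : ∀ t ∈ Set.Icc 0 S, HasDerivAt
      (fun t => x t ^ 2 + y t ^ 2 + (z t - (σ + ρ)) ^ 2 - (L * (σ + ρ)) ^ 2)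
      (2 * x t * (σ * (y t - x t)) + 2 * y t * (ρ * x t - y t - x t * z t)
        + 2 * (z t - (σ + ρ)) * (-β * z t + x t * y t)) t := fun t ht =>
    (((((h.hx t ht).pow 2).add ((h.hy t ht).pow 2)).add
      (((h.hz t ht).sub_const (σ + ρ)).pow 2)).sub_const _).congr_deriv (by simp)
  have := nonpos_of_deriv_add_nonpos m hS hd (fun t ht => by
    have h1 : 2 * x t * (σ * (y t - x t)) + 2 * y t * (ρ * x t - y t - x t * z t)
        + 2 * (z t - (σ + ρ)) * (-β * z t + x t * y t) =
        -2 * σ * x t ^ 2 - 2 * y t ^ 2 - β * (z t - (σ + ρ)) ^ 2 - β * z t ^ 2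
          + β * (σ + ρ) ^ 2 := by ring
    rw [h1]
    have h2 : 0 ≤ β * z t ^ 2 := by positivity
    have h3 : 0 ≤ (2 * σ - m) * x t ^ 2 := mul_nonneg (by linarith) (sq_nonneg _)
    have h4 : 0 ≤ (2 - m) * y t ^ 2 := mul_nonneg (by linarith) (sq_nonneg _)
    have h5 : 0 ≤ (β - m) * (z t - (σ + ρ)) ^ 2 := mul_nonneg (by linarith) (sq_nonneg _)
    have h6 : 0 ≤ (m * L ^ 2 - β) * (σ + ρ) ^ 2 := mul_nonneg (by linarith) (sq_nonneg _)
    linarith) (by linarith)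
  linarith

theorem sq_div_le_z (hσ : 0 < σ) (h2 : β < 2 * σ) {S : ℝ} (hS : 0 ≤ S)
    (h : IsLorenzSol σ ρ β x y z (Set.Icc 0 S)) (hz0 : z 0 = x 0 ^ 2 / (2 * σ)) :
    x S ^ 2 / (2 * σ) ≤ z S := by
  have := nonneg_of_deriv_add_nonneg (f := fun t => z t - x t ^ 2 / (2 * σ)) β hS
    (fun t ht => (h.hz t ht).sub (((h.hx t ht).pow 2).div_const (2 * σ))) (fun t ht => by
      have h1 : -β * z t + x t * y t - ((2 : ℕ) : ℝ) * x t ^ (2 - 1) * (σ * (y t - x t)) / (2 * σ)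
          + β * (z t - x t ^ 2 / (2 * σ)) = (2 * σ - β) * x t ^ 2 / (2 * σ) := by
        field_simp
        ring
      rw [h1]
      exact div_nonneg (mul_nonneg (by linarith) (sq_nonneg _)) (by linarith))
    (by simp [hz0])
  linarith

/-! #### Small parameters: no crossing of the plane `x = 0` -/

theorem ne_zero_of_energy_neg (hσ : 0 < σ) (hβ : 0 < β)
    (hρ : (σ + 4 / β - 2 / σ) ^ 2 * (ρ - 1) ≤ 4 * (σ + 1))
    (h : IsLorenzSol σ ρ β x y z (Set.Ici 0))
    (h0 : (σ * (y 0 - x 0)) ^ 2 / 2 - σ * (ρ - 1) * x 0 ^ 2 / 2 + σ / (4 * β) * x 0 ^ 4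
      + (x 0 ^ 2 / β - z 0) ^ 2 < 0) {t : ℝ} (ht : 0 ≤ t) : x t ≠ 0 := by
  set e : ℝ → ℝ := fun t => (σ * (y t - x t)) ^ 2 / 2 - σ * (ρ - 1) * x t ^ 2 / 2
    + σ / (4 * β) * x t ^ 4 + (x t ^ 2 / β - z t) ^ 2 with he
  set a := σ + 4 / β - 2 / σ with ha
  have hd : ∀ t ∈ Set.Ici (0 : ℝ), HasDerivAt e (-(σ + 1) * (σ * (y t - x t)) ^ 2
      - 2 * β * (x t ^ 2 / β - z t) ^ 2
      + a * x t * (σ * (y t - x t)) * (x t ^ 2 / β - z t)) t := by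
    intro t ht
    have hp := (h.hasDerivAt_sub ht).const_mul σ
    have hx := h.hx t ht
    refine (((((hp.pow 2).div_const 2).sub (((hx.pow 2).const_mul (σ * (ρ - 1))).div_const 2)).add
      ((hx.pow 4).const_mul (σ / (4 * β)))).add
      ((((hx.pow 2).div_const β).sub (h.hz t ht)).pow 2)).congr_deriv ?_
    simp only [ha, Pi.pow_apply, Pi.sub_apply, Nat.cast_ofNat, Nat.add_one_sub_one, pow_one]
    field_simp
    ring
  have hx2 : ∀ t, e t < 0 → a ^ 2 * x t ^ 2 ≤ 8 * β * (σ + 1) := by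
    intro t h1
    have h2 : σ * x t ^ 2 * (x t ^ 2 - 2 * β * (ρ - 1)) < 0 := by
      have h3 : σ / (4 * β) * x t ^ 4 - σ * (ρ - 1) * x t ^ 2 / 2 < 0 := by
        simp only [he] at h1
        nlinarith [sq_nonneg (σ * (y t - x t)), sq_nonneg (x t ^ 2 / β - z t)]
      have h4 : σ * x t ^ 2 * (x t ^ 2 - 2 * β * (ρ - 1)) =
          (4 * β) * (σ / (4 * β) * x t ^ 4 - σ * (ρ - 1) * x t ^ 2 / 2) := by
        field_simp
        ring
      rw [h4]
      exact mul_neg_of_pos_of_neg (by linarith) h3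
    have h5 : x t ^ 2 ≤ 2 * β * (ρ - 1) := by
      by_contra hcon
      have : 0 ≤ σ * x t ^ 2 * (x t ^ 2 - 2 * β * (ρ - 1)) :=
        mul_nonneg (by positivity) (by linarith)
      linarith
    calc a ^ 2 * x t ^ 2 ≤ a ^ 2 * (2 * β * (ρ - 1)) := by gcongr
      _ = 2 * β * (a ^ 2 * (ρ - 1)) := by ring
      _ ≤ 2 * β * (4 * (σ + 1)) := by gcongr
      _ = _ := by ring
  have hneg : e t < 0 := by
    by_contra hcon
    obtain ⟨s, hs0, -, hs, hlt⟩ := exists_first_eq ht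
      (fun r hr => (hd r hr.1).continuousAt.continuousWithinAt) h0 (not_lt.1 hcon)
    have := le_of_deriv_nonpos hs0.le (fun r hr => hd r hr.1) (fun r hr => by
      have h1 := hx2 r (hlt r hr.1.le hr.2)
      set p := σ * (y r - x r)
      set G := x r ^ 2 / β - z r
      have h2 : 0 ≤ (2 * (σ + 1) * p - a * x r * G) ^ 2 := sq_nonneg _
      have h3 : a ^ 2 * x r ^ 2 * G ^ 2 ≤ 8 * β * (σ + 1) * G ^ 2 := by gcongr
      have h4 : 4 * (σ + 1) * (-(σ + 1) * p ^ 2 - 2 * β * G ^ 2 + a * x r * p * G) ≤ 0 := by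
        nlinarith
      exact nonpos_of_mul_nonpos_right h4 (by linarith))
    simp only [hs] at this
    exact absurd this (not_le.2 h0)
  intro hx
  simp only [he, hx] at hneg
  nlinarith [sq_nonneg (σ * y t), sq_nonneg (z t)]

/-! #### Large parameters: monotone rise followed by descent -/

theorem hasDerivAt_ratio {I : Set ℝ} (h : IsLorenzSol σ ρ β x y z I) {t : ℝ} (ht : t ∈ I)
    (hx : x t ≠ 0) : HasDerivAt (fun s => σ * (y s - x s) / x s)
      (σ * (ρ - 1 - z t) - (σ + 1) * (σ * (y t - x t) / x t) - (σ * (y t - x t) / x t) ^ 2) t := by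
  refine (((h.hasDerivAt_sub ht).const_mul σ).div (h.hx t ht) hx).congr_deriv ?_
  field_simp
  ring

/-- The key differential inequality for the logarithmic derivative `r = x' / x`. -/
theorem ratio_deriv_lt (hσ : 0 < σ) {μ S : ℝ} (hμ : μ = (3 * σ - 1 - 2 * β) / 2) (hμ0 : 0 < μ)
    (hS : 0 ≤ S)
    (h : IsLorenzSol σ ρ β x y z (Set.Icc 0 S)) (hx : ∀ t ∈ Set.Icc 0 S, 0 < x t)
    {η : ℝ} (hη : 0 < η) (hηρ : η ^ 2 + (σ + 1) * η = σ * (ρ - 1))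
    (hy0 : σ * (y 0 - x 0) = η * x 0) (hz0 : z 0 = x 0 ^ 2 / (2 * σ))
    (hw : ∀ t, 0 ≤ t → t < S → (β + μ) * (z t - x t ^ 2 / (2 * σ)) ≤ μ * (ρ - 1)) :
    σ * (ρ - 1 - z S) - (σ + 1) * (σ * (y S - x S) / x S) - (σ * (y S - x S) / x S) ^ 2
      < -(x S ^ 2 / 4) + μ * (σ * (y S - x S) / x S) := by
  set Q : ℝ → ℝ := fun t => (σ * (y t - x t)) ^ 2 + x t ^ 4 / 4
    - (σ * (ρ - 1 - z t) + x t ^ 2 / 2) * x t ^ 2 + (σ + 1 + μ) * (x t * (σ * (y t - x t)))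
    with hQ
  have hd : ∀ t ∈ Set.Icc 0 S, HasDerivAt Q (-(σ + 1) * Q t
      + σ * x t ^ 2 * (μ * (ρ - 1) - (β + μ) * (z t - x t ^ 2 / (2 * σ)))
      + μ * (σ * (y t - x t)) ^ 2) t := by
    intro t ht
    have hp := (h.hasDerivAt_sub ht).const_mul σ
    have hx := h.hx t ht
    refine ((((hp.pow 2).add ((hx.pow 4).div_const 4)).sub
      (((((hasDerivAt_const t (ρ - 1)).sub (h.hz t ht)).const_mul σ).add
        ((hx.pow 2).div_const 2)).mul (hx.pow 2))).add
      ((hx.mul hp).const_mul (σ + 1 + μ))).congr_deriv ?_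
    simp only [hQ, hμ, Pi.pow_apply, Pi.sub_apply, Pi.add_apply, Nat.cast_ofNat]
    field_simp
    ring
  have hQ0 : 0 < Q 0 := by
    have hx0 := hx 0 ⟨le_rfl, hS⟩
    have : Q 0 = x 0 ^ 4 / 4 + μ * η * x 0 ^ 2 := by
      simp only [hQ, hy0, hz0]
      have : σ * (ρ - 1 - x 0 ^ 2 / (2 * σ)) = η ^ 2 + (σ + 1) * η - x 0 ^ 2 / 2 := by
        rw [hηρ]; field_simp
      rw [this]
      ring
    rw [this]
    positivity
  have hQS := pos_of_deriv_add_nonneg (σ + 1) hS hd (fun t ht => by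
    have h1 := hw t ht.1.le ht.2
    have h2 : 0 ≤ σ * x t ^ 2 * (μ * (ρ - 1) - (β + μ) * (z t - x t ^ 2 / (2 * σ))) :=
      mul_nonneg (by positivity) (by linarith)
    have h3 : 0 ≤ μ * (σ * (y t - x t)) ^ 2 := by positivity
    linarith) hQ0
  have hxS := hx S ⟨hS, le_rfl⟩
  have : -(x S ^ 2 / 4) + μ * (σ * (y S - x S) / x S) - (σ * (ρ - 1 - z S)
      - (σ + 1) * (σ * (y S - x S) / x S) - (σ * (y S - x S) / x S) ^ 2) = Q S / x S ^ 2 := by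
    simp only [hQ]
    field_simp
    ring
  have h2 : 0 < Q S / x S ^ 2 := by positivity
  linarith

end IsLorenzSol

namespace IsLorenzSol

variable {σ ρ β : ℝ} {x y z : ℝ → ℝ}

theorem ratio_le (hσ : 0 < σ) {η S : ℝ} (hη : 0 < η) (hS : 0 ≤ S)
    (hηρ : η ^ 2 + (σ + 1) * η = σ * (ρ - 1))
    (h : IsLorenzSol σ ρ β x y z (Set.Icc 0 S)) (hx : ∀ t ∈ Set.Icc 0 S, 0 < x t)
    (hz : ∀ t ∈ Set.Icc 0 S, 0 ≤ z t) (hy0 : σ * (y 0 - x 0) = η * x 0) :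
    σ * (y S - x S) / x S ≤ η := by
  have hx0 := hx 0 ⟨le_rfl, hS⟩
  have := le_of_deriv_nonneg_below (f := fun t => -(σ * (y t - x t) / x t)) (m := -η) (c := -η) hS
    (fun t ht => (h.hasDerivAt_ratio ht (hx t ht).ne').neg) (fun t ht hlt => by
      set r := σ * (y t - x t) / x t
      have h1 : η < r := by linarith
      have h2 : 0 ≤ σ * z t := mul_nonneg hσ.le (hz t ht)
      nlinarith) (by rw [hy0, mul_div_cancel_right₀ _ hx0.ne']) le_rfl
  linarith

theorem height_lt (hσ : 0 < σ) (hβ : 0 < β) (h2 : β < 2 * σ) {μ κ η Z S : ℝ}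
    (hμ : μ = (3 * σ - 1 - 2 * β) / 2) (hμ0 : 0 < μ) (hκ : κ = 1 - β / (2 * σ)) (hS : 0 ≤ S)
    (h : IsLorenzSol σ ρ β x y z (Set.Icc 0 S)) (hx : ∀ t ∈ Set.Icc 0 S, 0 < x t)
    (hη : 0 < η) (hηρ : η ^ 2 + (σ + 1) * η = σ * (ρ - 1))
    (hy0 : σ * (y 0 - x 0) = η * x 0) (hz0 : z 0 = x 0 ^ 2 / (2 * σ))
    (hZ : ∀ t ∈ Set.Icc 0 S, z t ≤ Z)
    (hW : (β + μ) * ((4 * κ * (β + μ) / β + 4 * κ) * η + κ * σ * Z / η) < μ * (ρ - 1))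
    (hw : ∀ t, 0 ≤ t → t < S → (β + μ) * (z t - x t ^ 2 / (2 * σ)) ≤ μ * (ρ - 1)) :
    (β + μ) * (z S - x S ^ 2 / (2 * σ)) < μ * (ρ - 1) := by
  have hκ0 : 0 < κ := by
    rw [hκ, sub_pos, div_lt_one (by linarith)]; exact h2
  set r : ℝ → ℝ := fun t => σ * (y t - x t) / x t with hr
  set w : ℝ → ℝ := fun t => z t - x t ^ 2 / (2 * σ) with hwdef
  have hsub : ∀ t ∈ Set.Icc 0 S, IsLorenzSol σ ρ β x y z (Set.Icc 0 t) := fun t ht =>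
    h.mono (Set.Icc_subset_Icc_right ht.2)
  have hSm : S ∈ Set.Icc 0 S := ⟨hS, le_rfl⟩
  have hwn : ∀ t ∈ Set.Icc 0 S, 0 ≤ w t := fun t ht =>
    sub_nonneg.2 ((hsub t ht).sq_div_le_z hσ h2 ht.1 hz0)
  have hx2 : ∀ t ∈ Set.Icc 0 S, x t ^ 2 ≤ 2 * σ * Z := by
    intro t ht
    have h3 := (hsub t ht).sq_div_le_z hσ h2 ht.1 hz0
    rw [div_le_iff₀ (by linarith)] at h3
    nlinarith [hZ t ht]
  have hrle : ∀ t ∈ Set.Icc 0 S, r t ≤ η := fun t ht =>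
    (hsub t ht).ratio_le hσ hη ht.1 hηρ (fun s hs => hx s ⟨hs.1, hs.2.trans ht.2⟩)
      (fun s hs => by
        have h3 := hwn s ⟨hs.1, hs.2.trans ht.2⟩
        have : 0 ≤ x s ^ 2 / (2 * σ) := by positivity
        simp only [hwdef] at h3
        linarith) hy0
  have hlt : ∀ t ∈ Set.Icc 0 S, σ * (ρ - 1 - z t) - (σ + 1) * r t - r t ^ 2
      < -(x t ^ 2 / 4) + μ * r t := fun t ht =>
    (hsub t ht).ratio_deriv_lt hσ hμ hμ0 ht.1 (fun s hs => hx s ⟨hs.1, hs.2.trans ht.2⟩)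
      hη hηρ hy0 hz0 (fun s h3 h4 => hw s h3 (h4.trans_le ht.2))
  have hwd : ∀ t ∈ Set.Icc 0 S, HasDerivAt w (-β * w t + κ * x t ^ 2) t := by
    intro t ht
    refine ((h.hz t ht).sub (((h.hx t ht).pow 2).div_const (2 * σ))).congr_deriv ?_
    simp only [hwdef, hκ]
    field_simp
    ring
  have hrd : ∀ t ∈ Set.Icc 0 S, HasDerivAt r
      (σ * (ρ - 1 - z t) - (σ + 1) * r t - r t ^ 2) t := fun t ht =>
    h.hasDerivAt_ratio ht (hx t ht).ne'
  set C := 4 * κ * (β + μ) / β with hC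
  have hCβ : C * β = 4 * κ * (β + μ) := by rw [hC]; field_simp
  have hC4 : 4 * κ ≤ C := by
    rw [hC, le_div_iff₀ hβ]; nlinarith [mul_pos hκ0 hμ0]
  have hr0 : r 0 = η := by
    simp only [hr, hy0]
    exact mul_div_cancel_right₀ _ (hx 0 ⟨le_rfl, hS⟩).ne'
  have hw0 : w 0 = 0 := by simp [hwdef, hz0]
  have hbound : ∀ t ∈ Set.Icc 0 S, w t + 4 * κ * r t - C * η ≤ 0 := by
    intro t ht
    refine nonpos_of_deriv_add_nonpos (f := fun t => w t + 4 * κ * r t - C * η) β ht.1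
      (fun s hs => ((hwd s ⟨hs.1, hs.2.trans ht.2⟩).add
        ((hrd s ⟨hs.1, hs.2.trans ht.2⟩).const_mul (4 * κ))).sub_const (C * η))
      (fun s hs => ?_) ?_
    · have hs' : s ∈ Set.Icc 0 S := ⟨hs.1.le, hs.2.le.trans ht.2⟩
      have h4 := mul_le_mul_of_nonneg_left (hlt s hs').le (by linarith : 0 ≤ 4 * κ)
      have h5 := mul_le_mul_of_nonneg_left (hrle s hs')
        (mul_nonneg (by linarith : 0 ≤ 4 * κ) (by linarith : 0 ≤ β + μ))
      nlinarith
    · simp only [hw0, hr0]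
      nlinarith
  have hZ0 : 0 ≤ Z := by
    have := hx2 S hSm
    nlinarith [sq_nonneg (x S)]
  have hβμ : 0 < β + μ := by linarith
  have hT0 : 0 ≤ κ * σ * Z / η := by positivity
  suffices w S ≤ (C + 4 * κ) * η + κ * σ * Z / η from
    (mul_le_mul_of_nonneg_left this hβμ.le).trans_lt hW
  rcases le_or_gt (-η) (r S) with h3 | h3
  · nlinarith [hbound S hSm]
  · obtain ⟨s, hs0, hsS, hrs, hs⟩ := exists_last_eq (f := r) hS
      (fun t ht => (hrd t ht).continuousAt.continuousWithinAt) (by rw [hr0]; linarith) h3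
    have hsm : s ∈ Set.Icc 0 S := ⟨hs0, hsS.le⟩
    have h4 := le_of_deriv_nonpos (f := fun t => w t + κ * x t ^ 2 / (2 * η)) hsS.le
      (fun t ht => (hwd t ⟨hs0.trans ht.1, ht.2⟩).add
        ((((h.hx t ⟨hs0.trans ht.1, ht.2⟩).pow 2).const_mul κ).div_const (2 * η)))
      (fun t ht => by
        have htm : t ∈ Set.Icc 0 S := ⟨hs0.trans ht.1.le, ht.2.le⟩
        have hxt := hx t htm
        have h5 : -β * w t + κ * x t ^ 2 +
            κ * (((2 : ℕ) : ℝ) * x t ^ (2 - 1) * (σ * (y t - x t))) / (2 * η)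
            = -β * w t + κ * x t ^ 2 * ((r t + η) / η) := by
          simp only [hr, Nat.cast_ofNat, Nat.add_one_sub_one, pow_one]
          field_simp
          ring
        rw [h5]
        have h6 : (r t + η) / η ≤ 0 :=
          div_nonpos_of_nonpos_of_nonneg (by linarith [hs t ht.1 ht.2.le]) hη.le
        have h7 := mul_nonneg hβ.le (hwn t htm)
        have h8 : κ * x t ^ 2 * ((r t + η) / η) ≤ 0 :=
          mul_nonpos_of_nonneg_of_nonpos (by positivity) h6
        linarith)
    have h5 : κ * x s ^ 2 / (2 * η) ≤ κ * σ * Z / η := by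
      rw [div_le_div_iff₀ (by linarith) hη]
      have := mul_le_mul_of_nonneg_left (hx2 s hsm) (mul_nonneg hκ0.le hη.le)
      nlinarith
    have h6 : 0 ≤ κ * x S ^ 2 / (2 * η) := by positivity
    have h7 := hbound s hsm
    rw [hrs] at h7
    linarith

theorem height_le (hσ : 0 < σ) (hβ : 0 < β) (h2 : β < 2 * σ) {μ κ η Z S : ℝ}
    (hμ : μ = (3 * σ - 1 - 2 * β) / 2) (hμ0 : 0 < μ) (hκ : κ = 1 - β / (2 * σ)) (hS : 0 ≤ S)
    (h : IsLorenzSol σ ρ β x y z (Set.Icc 0 S)) (hx : ∀ t ∈ Set.Icc 0 S, 0 < x t)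
    (hη : 0 < η) (hηρ : η ^ 2 + (σ + 1) * η = σ * (ρ - 1))
    (hy0 : σ * (y 0 - x 0) = η * x 0) (hz0 : z 0 = x 0 ^ 2 / (2 * σ))
    (hZ : ∀ t ∈ Set.Icc 0 S, z t ≤ Z)
    (hW : (β + μ) * ((4 * κ * (β + μ) / β + 4 * κ) * η + κ * σ * Z / η) < μ * (ρ - 1)) :
    (β + μ) * (z S - x S ^ 2 / (2 * σ)) ≤ μ * (ρ - 1) := by
  by_contra hcon
  have h0 : (β + μ) * (z 0 - x 0 ^ 2 / (2 * σ)) < μ * (ρ - 1) := by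
    rw [hz0, sub_self, mul_zero]
    have : 0 < σ * (ρ - 1) := by rw [← hηρ]; positivity
    exact mul_pos hμ0 (pos_of_mul_pos_right this hσ.le)
  obtain ⟨s, hs0, hsS, hs, hlt⟩ := exists_first_eq
    (f := fun t => (β + μ) * (z t - x t ^ 2 / (2 * σ))) hS
    (fun t ht => ((((h.hz t ht).sub (((h.hx t ht).pow 2).div_const (2 * σ))).const_mul
      (β + μ)).continuousAt).continuousWithinAt) h0 (not_le.1 hcon).le
  have hsub : Set.Icc 0 s ⊆ Set.Icc 0 S := Set.Icc_subset_Icc_right hsS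
  have := (h.mono hsub).height_lt hσ hβ h2 hμ hμ0 hκ hs0.le (fun t ht => hx t (hsub ht)) hη hηρ
    hy0 hz0 (fun t ht => hZ t (hsub ht)) hW (fun t h3 h4 => (hlt t h3 h4).le)
  linarith

/-- A scalar function obeying a Riccati inequality and decreasing exponentially blows down. -/
theorem blow_down {r r' : ℝ → ℝ} {a μ A k : ℝ} (hμ0 : 0 < μ) (hA : 0 ≤ A) (hk : 0 ≤ k)
    (hrd : ∀ t, a ≤ t → HasDerivAt r (r' t) t) (h1 : ∀ t, a ≤ t → r' t ≤ μ * r t)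
    (h2 : ∀ t, a ≤ t → r' t ≤ A - k * r t - r t ^ 2) (hra : r a < 0) : False := by
  have hneg : ∀ t, a ≤ t → r t < 0 := fun t ht =>
    neg_of_deriv_add_nonpos (-μ) ht (fun s hs => hrd s hs.1)
      (fun s hs => by linarith [h1 s hs.1.le]) hra
  have hrle : ∀ t, a ≤ t → r t ≤ r a := fun t ht =>
    le_of_deriv_nonpos ht (fun s hs => hrd s hs.1) (fun s hs =>
      (h1 s hs.1.le).trans (mul_nonpos_of_nonneg_of_nonpos hμ0.le (hneg s hs.1.le).le))
  have hrlin : ∀ t, a ≤ t → r t ≤ r a + μ * r a * (t - a) := by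
    intro t ht
    have := le_of_deriv_nonpos (f := fun t => r t - μ * r a * (t - a)) ht
      (fun s hs => (hrd s hs.1).sub (((hasDerivAt_id s).sub_const a).const_mul (μ * r a)))
      (fun s hs => by
        have h3 := h1 s hs.1.le
        have h4 := mul_le_mul_of_nonneg_left (hrle s hs.1.le) hμ0.le
        linarith)
    simp only [sub_self, mul_zero, sub_zero] at this
    linarith
  set B := 2 * k + 1 + 2 * A with hB
  have hBpos : 0 < B := by positivity
  set b := a + B / (μ * -(r a)) with hb
  have hμr : 0 < μ * -(r a) := mul_pos hμ0 (by linarith)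
  have hab : a ≤ b := by
    have : 0 < B / (μ * -(r a)) := div_pos hBpos hμr
    linarith
  have hrb : ∀ t, b ≤ t → r t ≤ -B := by
    intro t ht
    have h3 := hrlin t (hab.trans ht)
    have h4 : B / (μ * -(r a)) ≤ t - a := by linarith
    rw [div_le_iff₀ hμr] at h4
    linarith
  have hinv : ∀ t, b ≤ t → (r b)⁻¹ + (t - b) / 2 ≤ (r t)⁻¹ := by
    intro t ht
    have := le_of_deriv_nonneg (f := fun t => (r t)⁻¹ - (t - b) / 2) ht
      (fun s hs => ((hrd s (hab.trans hs.1)).inv (hneg s (hab.trans hs.1)).ne).sub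
        (((hasDerivAt_id s).sub_const b).div_const 2))
      (fun s hs => by
        have h3 := hrb s hs.1.le
        have h4 : 0 < r s ^ 2 := sq_pos_of_neg (hneg s (hab.trans hs.1.le))
        have h5 : 1 / 2 ≤ -(r' s) / r s ^ 2 := by
          rw [le_div_iff₀ h4]
          have h6 := h2 s (hab.trans hs.1.le)
          have h7 : B * -(r s) ≤ -(r s) * -(r s) :=
            mul_le_mul_of_nonneg_right (by linarith) (by linarith)
          have h9 : B * -(r s) = 2 * (k * -(r s)) + -(r s) + 2 * (A * -(r s)) := by
            rw [hB]; ring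
          have h11 : A * 1 ≤ A * -(r s) := mul_le_mul_of_nonneg_left (by linarith) hA
          have h12 : r s ^ 2 = -(r s) * -(r s) := by ring
          linarith
        linarith)
    simp only [sub_self, zero_div, sub_zero] at this
    linarith
  have hbi : (r b)⁻¹ < 0 := inv_lt_zero.2 (hneg b hab)
  have h3 := hinv (b + 2 * (-(r b)⁻¹)) (by linarith)
  have h4 : (r (b + 2 * (-(r b)⁻¹)))⁻¹ < 0 := inv_lt_zero.2 (hneg _ (by linarith))
  linarith

/-- For large parameters the trajectory rises and then descends to `x = 0`. -/
theorem exists_isWeakDescent (hσ : 0 < σ) (hβ : 0 < β) (hσβ : 2 * β + 1 < 3 * σ) {μ κ η Z : ℝ}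
    (hμ : μ = (3 * σ - 1 - 2 * β) / 2) (hκ : κ = 1 - β / (2 * σ))
    (h : IsLorenzSol σ ρ β x y z (Set.Ici 0)) (hx0 : 0 < x 0)
    (hη : 0 < η) (hηρ : η ^ 2 + (σ + 1) * η = σ * (ρ - 1))
    (hy0 : σ * (y 0 - x 0) = η * x 0) (hz0 : z 0 = x 0 ^ 2 / (2 * σ))
    (hZ : ∀ t, 0 ≤ t → z t ≤ Z)
    (hW : (β + μ) * ((4 * κ * (β + μ) / β + 4 * κ) * η + κ * σ * Z / η) < μ * (ρ - 1)) (c : ℝ) :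
    ∃ t₁ T, IsWeakDescent c x y t₁ T := by
  have h2 : β < 2 * σ := by linarith
  have hμ0 : 0 < μ := by linarith
  set r : ℝ → ℝ := fun t => σ * (y t - x t) / x t with hr
  have hsub : ∀ t, IsLorenzSol σ ρ β x y z (Set.Icc 0 t) := fun t => h.mono Set.Icc_subset_Ici_self
  have hcx : ∀ t, 0 ≤ t → ContinuousAt x t := fun t ht => (h.hx t ht).continuousAt
  have hrd : ∀ t, 0 ≤ t → x t ≠ 0 → HasDerivAt r
      (σ * (ρ - 1 - z t) - (σ + 1) * r t - r t ^ 2) t := fun t ht hx =>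
    h.hasDerivAt_ratio ht hx
  have hlt : ∀ S, 0 ≤ S → (∀ t ∈ Set.Icc 0 S, 0 < x t) →
      σ * (ρ - 1 - z S) - (σ + 1) * r S - r S ^ 2 < -(x S ^ 2 / 4) + μ * r S := by
    intro S hS hx
    refine (hsub S).ratio_deriv_lt hσ hμ hμ0 hS hx hη hηρ hy0 hz0 (fun t h3 h4 => ?_)
    exact (hsub t).height_le hσ hβ h2 hμ hμ0 hκ h3 (fun s hs => hx s ⟨hs.1, hs.2.trans h4.le⟩) hη
      hηρ hy0 hz0 (fun s hs => hZ s hs.1) hW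
  have hx2 : ∀ t, 0 ≤ t → x t ^ 2 ≤ 2 * σ * Z := by
    intro t ht
    have h3 := (hsub t).sq_div_le_z hσ h2 ht hz0
    rw [div_le_iff₀ (by linarith)] at h3
    nlinarith [hZ t ht]
  have hpersist : ∀ a b, 0 ≤ a → a ≤ b → (∀ t ∈ Set.Icc 0 b, 0 < x t) → y a < x a →
      r b ≤ r a ∧ y b < x b := by
    intro a b ha hab hx hya
    have hrneg : ∀ t ∈ Set.Icc a b, r t < 0 := by
      intro t ht
      refine neg_of_deriv_add_nonpos (-μ) ht.1 (fun s hs => hrd s (ha.trans hs.1)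
        (hx s ⟨ha.trans hs.1, hs.2.trans ht.2⟩).ne') (fun s hs => ?_) ?_
      · have := hlt s (ha.trans hs.1.le)
          (fun q hq => hx q ⟨hq.1, hq.2.trans (hs.2.le.trans ht.2)⟩)
        nlinarith [sq_nonneg (x s)]
      · exact div_neg_of_neg_of_pos (by nlinarith) (hx a ⟨ha, hab⟩)
    refine ⟨le_of_deriv_nonpos hab (fun s hs => hrd s (ha.trans hs.1)
        (hx s ⟨ha.trans hs.1, hs.2⟩).ne') (fun s hs => ?_), ?_⟩
    · have := hlt s (ha.trans hs.1.le) (fun q hq => hx q ⟨hq.1, hq.2.trans hs.2.le⟩)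
      nlinarith [sq_nonneg (x s), hrneg s ⟨hs.1.le, hs.2.le⟩]
    · have h3 := hrneg b ⟨hab, le_rfl⟩
      simp only [hr] at h3
      rw [div_neg_iff] at h3
      have := hx b ⟨ha.trans hab, le_rfl⟩
      rcases h3 with ⟨-, h3⟩ | ⟨h3, -⟩
      · linarith
      · nlinarith
  have hzero : ∃ t, 0 ≤ t ∧ x t ≤ 0 := by
    by_contra! hpos
    by_cases hcase : ∃ a, 0 ≤ a ∧ y a < x a
    · obtain ⟨a, ha, hya⟩ := hcase
      have hra : r a < 0 := div_neg_of_neg_of_pos (by nlinarith) (hpos a ha)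
      exact blow_down (A := σ * (ρ - 1)) (k := σ + 1) hμ0
        (by rw [← hηρ]; positivity) (by linarith)
        (fun t ht => hrd t (ha.trans ht) (hpos t (ha.trans ht)).ne')
        (fun t ht => by
          have := hlt t (ha.trans ht) (fun s hs => hpos s hs.1)
          linarith [sq_nonneg (x t)])
        (fun t ht => by
          have hzs : 0 ≤ z t := le_trans (by positivity)
            ((hsub t).sq_div_le_z hσ h2 (ha.trans ht) hz0)
          linarith [mul_nonneg hσ.le hzs]) hra
    · push Not at hcase
      have hxge : ∀ t, 0 ≤ t → x 0 ≤ x t := fun t ht =>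
        le_of_deriv_nonneg ht (hsub t).hx (fun s hs =>
          mul_nonneg hσ.le (by linarith [hcase s hs.1.le]))
      have hr0 : ∀ t, 0 ≤ t → 0 ≤ r t := fun t ht =>
        div_nonneg (mul_nonneg hσ.le (by linarith [hcase t ht])) (hpos t ht).le
      have hlin : ∀ t, 0 ≤ t → x 0 ^ 2 / 4 * t ≤ η + μ / x 0 * x t := by
        intro t ht
        have := le_of_deriv_nonpos (f := fun t => r t - μ / x 0 * x t + x 0 ^ 2 / 4 * t) ht
          (fun s hs => ((hrd s hs.1 (hpos s hs.1).ne').sub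
            ((h.hx s hs.1).const_mul (μ / x 0))).add ((hasDerivAt_id s).const_mul (x 0 ^ 2 / 4)))
          (fun s hs => by
            have h3 := hlt s hs.1.le (fun q hq => hpos q hq.1)
            have hxs := hpos s hs.1.le
            have h4 : σ * (y s - x s) = r s * x s := by
              simp only [hr]; field_simp
            have h5 : μ * r s ≤ μ / x 0 * (r s * x s) := by
              have : μ / x 0 * (r s * x s) = μ * r s * (x s / x 0) := by ring
              rw [this]
              exact le_mul_of_one_le_right (mul_nonneg hμ0.le (hr0 s hs.1.le))
                ((one_le_div hx0).2 (hxge s hs.1.le))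
            have h6 : x 0 ^ 2 ≤ x s ^ 2 := by gcongr; exact hxge s hs.1.le
            rw [h4]
            linarith)
        have h7 : r 0 = η := by
          simp only [hr, hy0]
          exact mul_div_cancel_right₀ _ hx0.ne'
        have h8 : 0 ≤ μ / x 0 * x 0 := by positivity
        simp only [h7, mul_zero, add_zero] at this
        linarith [hr0 t ht]
      have hxle : ∀ t, 0 ≤ t → x t ≤ 2 * σ * Z + 1 := fun t ht => by
        nlinarith [hx2 t ht, sq_nonneg (x t - 1)]
      have hK : 0 < η + μ / x 0 * (2 * σ * Z + 1) + 1 := by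
        have := hxle 0 le_rfl
        have h3 : 0 ≤ μ / x 0 * (2 * σ * Z + 1) := mul_nonneg (by positivity) (by linarith)
        linarith
      have h3 := hlin ((η + μ / x 0 * (2 * σ * Z + 1) + 1) / (x 0 ^ 2 / 4)) (by positivity)
      rw [mul_div_cancel₀ _ (by positivity)] at h3
      have h4 := mul_le_mul_of_nonneg_left (hxle
        ((η + μ / x 0 * (2 * σ * Z + 1) + 1) / (x 0 ^ 2 / 4)) (by positivity))
        (by positivity : 0 ≤ μ / x 0)
      linarith
  obtain ⟨T', hT', hxT'⟩ := hzero
  obtain ⟨T, hT0, -, hxT, hTpos⟩ := exists_first_eq (f := fun t => -x t) (m := 0) hT'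
    (fun t ht => ((hcx t ht.1).continuousWithinAt).neg) (by linarith) (by linarith)
  have hxT : x T = 0 := by linarith
  have hTpos : ∀ t, 0 ≤ t → t < T → 0 < x t := fun t h3 h4 => by linarith [hTpos t h3 h4]
  obtain ⟨a, ha, haT, hya⟩ : ∃ a, 0 ≤ a ∧ a < T ∧ y a < x a := by
    by_contra! hcon
    have := le_of_deriv_nonneg hT0.le (hsub T).hx (fun s hs =>
      mul_nonneg hσ.le (by linarith [hcon s hs.1.le hs.2]))
    linarith
  have hy0' : 0 < y 0 - x 0 := by
    have : 0 < σ * (y 0 - x 0) := by rw [hy0]; positivity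
    exact pos_of_mul_pos_right this hσ.le
  obtain ⟨t₁, ht1, ht1a, heq, hlast⟩ := exists_last_eq (f := fun t => y t - x t) (m := 0) ha
    (fun t ht => (h.hasDerivAt_sub ht.1).continuousAt.continuousWithinAt) hy0'.le (by linarith)
  refine ⟨t₁, T, ht1, by linarith, fun t ht => Or.inl ?_, fun t ht => Or.inl ?_, hxT.le⟩
  · by_contra! hcon
    have := (hpersist t t₁ ht.1 ht.2 (fun s hs => hTpos s hs.1 (by linarith [hs.2])) hcon).2
    linarith
  · rcases eq_or_lt_of_le ht.2 with h3 | h3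
    · by_contra! hcon
      rw [h3] at hcon
      have h4 := (eventually_sign_of_deriv_pos (h.hx T hT0.le)
        (mul_pos hσ (by linarith)) hxT).1
      obtain ⟨s, h5, h6⟩ := (h4.and (Ioo_mem_nhdsLT hT0)).exists
      linarith [hTpos s h6.1.le h6.2]
    · rcases le_or_gt t a with h4 | h4
      · rcases eq_or_lt_of_le ht.1 with h5 | h5
        · rw [← h5]; linarith
        · linarith [hlast t h5 h4]
      · exact (hpersist a t ha h4.le (fun s hs => hTpos s hs.1 (hs.2.trans_lt h3)) hya).2.le

end IsLorenzSol

theorem isOpen_setOf_exists_isDescent {X Y : ℝ → ℝ → ℝ} {c : ℝ → ℝ}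
    (hX : Continuous fun q : ℝ × ℝ => X q.1 q.2) (hY : Continuous fun q : ℝ × ℝ => Y q.1 q.2)
    (hc : Continuous c) (B : ℝ) :
    IsOpen {l : ℝ | ∃ t₁ T, T < B ∧ IsDescent (c l) (X l) (Y l) t₁ T} := by
  rw [isOpen_iff_mem_nhds]
  rintro l ⟨t₁, T, hTB, h⟩
  have hc' : Continuous fun q : ℝ × ℝ => c q.1 := hc.comp continuous_fst
  have hup : ∀ᶠ l' in 𝓝 l, ∀ t ∈ Set.Icc 0 t₁, X l' t < Y l' t ∨ c l' < X l' t := by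
    refine isCompact_Icc.eventually_forall_of_forall_eventually (fun t ht => ?_)
    exact ((isOpen_lt hX hY).union (isOpen_lt hc' hX)).mem_nhds (h.up t ht)
  have hdown : ∀ᶠ l' in 𝓝 l, ∀ t ∈ Set.Icc t₁ T, Y l' t < X l' t ∨ c l' < X l' t := by
    refine isCompact_Icc.eventually_forall_of_forall_eventually (fun t ht => ?_)
    exact ((isOpen_lt hY hX).union (isOpen_lt hc' hX)).mem_nhds (h.down t ht)
  have hneg : ∀ᶠ l' in 𝓝 l, X l' T < 0 :=
    (hX.comp (by fun_prop : Continuous fun l : ℝ => (l, T))).continuousAt.eventually_lt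
      continuousAt_const h.neg
  filter_upwards [hup, hdown, hneg] with l' h1 h2 h3
  exact ⟨t₁, T, hTB, h.nonneg, h.le, h1, h2, h3⟩

theorem exists_isWeakDescent_of_mem_closure {X Y : ℝ → ℝ → ℝ} {c : ℝ → ℝ}
    (hX : Continuous fun q : ℝ × ℝ => X q.1 q.2) (hY : Continuous fun q : ℝ × ℝ => Y q.1 q.2)
    (hc : Continuous c) {B l : ℝ}
    (hl : l ∈ closure {l : ℝ | ∃ t₁ T, T < B ∧ IsDescent (c l) (X l) (Y l) t₁ T}) :
    ∃ t₁ T, IsWeakDescent (c l) (X l) (Y l) t₁ T := by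
  obtain ⟨𝒱, h𝒱, h𝒱l⟩ := mem_closure_iff_ultrafilter.1 hl
  have h𝒱' : ∀ᶠ l' in (𝒱 : Filter ℝ), ∃ t₁ T, T < B ∧ IsDescent (c l') (X l') (Y l') t₁ T := h𝒱
  obtain ⟨τ₁, h1⟩ := h𝒱'.choice
  obtain ⟨τ, h2⟩ := h1.choice
  obtain ⟨s₁, -, hs₁⟩ := (isCompact_Icc (a := (0 : ℝ)) (b := B)).ultrafilter_le_nhds' (𝒱.map τ₁)
    (h2.mono fun l' h => ⟨h.2.nonneg, h.2.le.trans h.1.le⟩)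
  obtain ⟨s, -, hs⟩ := (isCompact_Icc (a := (0 : ℝ)) (b := B)).ultrafilter_le_nhds' (𝒱.map τ)
    (h2.mono fun l' h => ⟨h.2.nonneg.trans h.2.le, h.1.le⟩)
  have hs₁ : Tendsto τ₁ 𝒱 (𝓝 s₁) := hs₁
  have hs : Tendsto τ 𝒱 (𝓝 s) := hs
  have hid : Tendsto (fun l' : ℝ => l') 𝒱 (𝓝 l) := h𝒱l
  have hXl : ∀ {f : ℝ → ℝ} {t : ℝ}, Tendsto f 𝒱 (𝓝 t) →
      Tendsto (fun l' => X l' (f l')) 𝒱 (𝓝 (X l t)) := fun hf =>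
    (hX.tendsto (l, _)).comp (hid.prodMk_nhds hf)
  have hYl : ∀ {f : ℝ → ℝ} {t : ℝ}, Tendsto f 𝒱 (𝓝 t) →
      Tendsto (fun l' => Y l' (f l')) 𝒱 (𝓝 (Y l t)) := fun hf =>
    (hY.tendsto (l, _)).comp (hid.prodMk_nhds hf)
  have hcl : Tendsto c 𝒱 (𝓝 (c l)) := (hc.tendsto l).comp hid
  refine ⟨s₁, s, ge_of_tendsto hs₁ (h2.mono fun l' h => h.2.nonneg),
    le_of_tendsto_of_tendsto hs₁ hs (h2.mono fun l' h => h.2.le), fun t ht => ?_, fun t ht => ?_,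
    le_of_tendsto (hXl hs) (h2.mono fun l' h => h.2.neg.le)⟩
  · have hf : Tendsto (fun l' => min t (τ₁ l')) 𝒱 (𝓝 t) := by
      simpa [min_eq_left ht.2] using (tendsto_const_nhds (x := t)).min hs₁
    rcases Ultrafilter.eventually_or.1
      (h2.mono fun l' h => h.2.up (min t (τ₁ l')) ⟨le_min ht.1 h.2.nonneg, min_le_right _ _⟩)
      with h3 | h3
    · exact Or.inl (le_of_tendsto_of_tendsto (hXl hf) (hYl hf) (h3.mono fun _ h => h.le))
    · exact Or.inr (le_of_tendsto_of_tendsto hcl (hXl hf) (h3.mono fun _ h => h.le))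
  · have hf : Tendsto (fun l' => max (τ₁ l') (min t (τ l'))) 𝒱 (𝓝 t) := by
      simpa [min_eq_left ht.2, max_eq_right ht.1] using
        hs₁.max ((tendsto_const_nhds (x := t)).min hs)
    rcases Ultrafilter.eventually_or.1
      (h2.mono fun l' h => h.2.down (max (τ₁ l') (min t (τ l')))
        ⟨le_max_left _ _, max_le h.2.le (min_le_right _ _)⟩) with h3 | h3
    · exact Or.inl (le_of_tendsto_of_tendsto (hYl hf) (hXl hf) (h3.mono fun _ h => h.le))
    · exact Or.inr (le_of_tendsto_of_tendsto hcl (hXl hf) (h3.mono fun _ h => h.le))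

/-- Along a path of trajectories on which weak descents can be made strict, from one without
descent to one with descent, arbitrarily late descents occur. -/
theorem exists_late_descent {X Y : ℝ → ℝ → ℝ} {c : ℝ → ℝ}
    (hX : Continuous fun q : ℝ × ℝ => X q.1 q.2) (hY : Continuous fun q : ℝ × ℝ => Y q.1 q.2)
    (hc : Continuous c) {a b : ℝ} (hab : a ≤ b)
    (hweak : ∀ l ∈ Set.Icc a b, ∀ t₁ T, IsWeakDescent (c l) (X l) (Y l) t₁ T →
      ∃ t₁ T, IsDescent (c l) (X l) (Y l) t₁ T)
    (ha : ∀ t₁ T, ¬ IsDescent (c a) (X a) (Y a) t₁ T)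
    (hb : ∃ t₁ T, IsWeakDescent (c b) (X b) (Y b) t₁ T) (N : ℝ) :
    ∃ l ∈ Set.Icc a b, (∃ t₁ T, IsDescent (c l) (X l) (Y l) t₁ T) ∧
      ∀ t₁ T, IsDescent (c l) (X l) (Y l) t₁ T → N < T := by
  by_contra! hcon
  have hmem : ∀ l ∈ Set.Icc a b, (∃ t₁ T, IsWeakDescent (c l) (X l) (Y l) t₁ T) →
      ∃ t₁ T, T < N + 1 ∧ IsDescent (c l) (X l) (Y l) t₁ T := by
    rintro l hl ⟨t₁, T, h⟩
    obtain ⟨t₁, T, h1, h2⟩ := hcon l hl (hweak l hl t₁ T h)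
    exact ⟨t₁, T, by linarith, h1⟩
  have hbm : b ∈ Set.Icc a b := ⟨hab, le_rfl⟩
  obtain ⟨t₁, T, -, h⟩ := isPreconnected_Icc.subset_of_closure_inter_subset
    (isOpen_setOf_exists_isDescent hX hY hc (N + 1)) ⟨b, hbm, hmem b hbm hb⟩
    (fun l hl => hmem l hl.2 (exists_isWeakDescent_of_mem_closure hX hY hc hl.1))
    (⟨le_rfl, hab⟩ : a ∈ Set.Icc a b)
  exact ha t₁ T h

/-- A long passage: a rise to the level `δ` at time `a`, an excursion above `δ` until time `h`,
and then a time at least `a + N - h` spent below `δ`. -/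
structure IsPassage (c δ N : ℝ) (x y : ℝ → ℝ) (a t₁ h : ℝ) : Prop where
  pos : 0 ≤ a
  le : a ≤ h
  xa : x a = δ
  xh : x h = δ
  rise : ∀ t ∈ Set.Icc 0 a, 0 ≤ x t ∧ x t ≤ δ ∧ x t ≤ y t
  above : ∀ t ∈ Set.Icc a h, δ ≤ x t
  up : ∀ t ∈ Set.Icc 0 t₁, x t ≤ y t ∨ c ≤ x t
  down : ∀ t ∈ Set.Icc t₁ h, y t ≤ x t ∨ c ≤ x t
  decay : ∀ t ∈ Set.Icc h (a + N), 0 ≤ x t ∧ x t ≤ δ ∧ y t ≤ x t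

namespace IsLorenzSol

variable {σ ρ β c δ : ℝ} {x y z : ℝ → ℝ}

theorem exists_isPassage (hσ : 0 < σ) (hβ : 0 < β) (h2 : β < 2 * σ)
    (h : IsLorenzSol σ ρ β x y z (Set.Ici 0)) (h0 : 0 < x 0) (h0δ : x 0 < δ) (hy0 : 0 < y 0)
    (hz0 : z 0 < x 0 ^ 2 / β) (hδc : δ < c) {g R N : ℝ} (hg : 0 < g)
    (hgρ : g ≤ ρ - 1 - δ ^ 2 / β) (hR : ∀ t, 0 ≤ t → x t ≤ R ∧ y t ≤ R)
    (hex : ∃ t₁ T, IsDescent c x y t₁ T)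
    (hlate : ∀ t₁ T, IsDescent c x y t₁ T → (σ + 1) * R / (σ * x 0 * g) + N < T) :
    ∃ a t₁ b, IsPassage c δ N x y a t₁ b := by
  obtain ⟨t₁, T, hd⟩ := hex
  have hsub : ∀ a b, 0 ≤ a → IsLorenzSol σ ρ β x y z (Set.Icc a b) := fun a b ha =>
    h.mono (fun t ht => ha.trans ht.1)
  have hcx : ∀ t, 0 ≤ t → ContinuousAt x t := fun t ht => (h.hx t ht).continuousAt
  have hmono : ∀ s t m, 0 ≤ s → s ≤ t → t ≤ t₁ → m ≤ x s → m ≤ c → m ≤ x t := by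
    intro s t m hs hst ht hm hmc
    refine le_of_deriv_nonneg_below hst (hsub s t hs).hx (fun q hq hlt => ?_) hm hmc
    rcases hd.up q ⟨hs.trans hq.1, hq.2.trans ht⟩ with h3 | h3
    · exact mul_nonneg hσ.le (by linarith)
    · linarith
  have hct₁ : c < x t₁ := by
    rcases hd.up t₁ ⟨hd.nonneg, le_rfl⟩ with h3 | h3
    · exact (hd.down t₁ ⟨le_rfl, hd.le⟩).resolve_left (by linarith)
    · exact h3
  obtain ⟨a, ha0, hat₁, hxa, halt⟩ := exists_first_eq hd.nonneg
    (fun t ht => (hcx t ht.1).continuousWithinAt) h0δ (by linarith)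
  have hrise : ∀ t ∈ Set.Icc 0 a, x 0 ≤ x t ∧ x t ≤ δ ∧ x t ≤ y t := by
    intro t ht
    have hle : x t ≤ δ := by
      rcases eq_or_lt_of_le ht.2 with h3 | h3
      · rw [h3, hxa]
      · exact (halt t ht.1 h3).le
    exact ⟨hmono 0 t (x 0) le_rfl ht.1 (ht.2.trans hat₁) le_rfl (by linarith), hle,
      ((hd.up t ⟨ht.1, ht.2.trans hat₁⟩).resolve_right (by linarith)).le⟩
  have haA : a ≤ (σ + 1) * R / (σ * x 0 * g) := by
    have hK : 0 < σ * x 0 * g := by positivity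
    have h3 := le_of_deriv_nonneg (f := fun t => σ * y t + x t - σ * x 0 * g * t) ha0.le
      (fun t ht => (((h.hy t ht.1).const_mul σ).add (h.hx t ht.1)).sub
        ((hasDerivAt_id t).const_mul (σ * x 0 * g))) (fun t ht => by
        have hz := (hsub 0 t le_rfl).z_lt_sq_div hβ h2 ht.1.le (fun s hs =>
          ⟨h0.le.trans (hrise s ⟨hs.1, hs.2.trans ht.2.le⟩).1,
            (hrise s ⟨hs.1, hs.2.trans ht.2.le⟩).2.2⟩) hz0
        obtain ⟨h4, h5, -⟩ := hrise t ⟨ht.1.le, ht.2.le⟩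
        have h6 : x t ^ 2 / β ≤ δ ^ 2 / β := by gcongr; linarith
        have h7 : x 0 * g ≤ x t * (ρ - 1 - z t) := by
          apply mul_le_mul h4 _ hg.le (by linarith)
          linarith
        have h8 := mul_le_mul_of_nonneg_left h7 hσ.le
        linarith)
    rw [le_div_iff₀ hK]
    obtain ⟨h4, h5⟩ := hR a ha0.le
    have h6 := mul_le_mul_of_nonneg_left h5 hσ.le
    simp only [mul_zero, sub_zero] at h3
    have h7 : 0 < σ * y 0 := by positivity
    linarith
  obtain ⟨b, hb1, hbT, hxb, hblt⟩ := exists_last_eq (m := δ) hd.le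
    (fun t ht => (hcx t (hd.nonneg.trans ht.1)).continuousWithinAt) (by linarith)
    (by linarith [hd.neg])
  have hNT : a + N < T := by linarith [hlate t₁ T hd]
  refine ⟨a, t₁, b, ha0.le, hat₁.trans hb1, hxa, hxb,
    fun t ht => ⟨h0.le.trans (hrise t ht).1, (hrise t ht).2⟩, fun t ht => ?_, hd.weak.up,
    fun t ht => hd.weak.down t ⟨ht.1, ht.2.trans hbT.le⟩, fun t ht => ?_⟩
  · rcases le_total t t₁ with h3 | h3
    · exact hmono a t δ ha0.le ht.1 h3 hxa.ge hδc.le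
    · refine le_of_deriv_nonpos_below (c := c) ht.2 (hsub t b (ha0.le.trans ht.1)).hx
        (fun q hq hlt => ?_) hxb.ge hδc.le
      rcases hd.down q ⟨h3.trans hq.1, hq.2.trans hbT.le⟩ with h4 | h4
      · exact mul_nonpos_of_nonneg_of_nonpos hσ.le (by linarith)
      · linarith
  · have htT : t ≤ T := ht.2.trans hNT.le
    have hle : x t ≤ δ := by
      rcases eq_or_lt_of_le ht.1 with h3 | h3
      · rw [← h3, hxb]
      · exact (hblt t h3 htT).le
    refine ⟨?_, hle,
      ((hd.down t ⟨hb1.trans ht.1, htT⟩).resolve_right (by linarith)).le⟩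
    by_contra! hneg
    have := hlate t₁ t ⟨hd.nonneg, hb1.trans ht.1, hd.up,
      fun s hs => hd.down s ⟨hs.1, hs.2.trans htT⟩, hneg⟩
    linarith [ht.2]

end IsLorenzSol

theorem nonpos_of_deriv_le_of_bounded {f f' : ℝ → ℝ} {k a B : ℝ} (hk : 0 < k)
    (hf : ∀ t ≤ a, HasDerivAt f (f' t) t) (h : ∀ t ≤ a, f' t ≤ -k * f t)
    (hB : ∀ t ≤ a, f t ≤ B) : f a ≤ 0 := by
  have key : ∀ s ≤ a, f a * Real.exp (k * a) ≤ B * Real.exp (k * s) := by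
    intro s hs
    have h1 := mul_exp_le_of_deriv_add_nonneg (f := fun t => -f t) k hs
      (fun t ht => (hf t ht.2).neg) (fun t ht => by linarith [h t ht.2.le])
    have h2 := mul_le_mul_of_nonneg_right (hB s hs) (Real.exp_pos (k * s)).le
    linarith
  have hlim : Tendsto (fun s => B * Real.exp (k * s)) atBot (𝓝 (B * 0)) :=
    (Real.tendsto_exp_atBot.comp (tendsto_id.const_mul_atBot hk)).const_mul B
  rw [mul_zero] at hlim
  have h3 := ge_of_tendsto hlim ((eventually_le_atBot a).mono key)
  exact nonpos_of_mul_nonpos_left h3 (Real.exp_pos _)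

theorem exists_tendsto_atBot_of_antitone {f : ℝ → ℝ} {a B : ℝ}
    (hf : ∀ s t, s ≤ t → t ≤ a → f t ≤ f s) (hB : ∀ t ≤ a, f t ≤ B) :
    ∃ m, Tendsto f atBot (𝓝 m) ∧ ∀ t ≤ a, f t ≤ m := by
  have hanti : Antitone fun t => f (min t a) := fun s t hst =>
    hf _ _ (min_le_min_right a hst) (min_le_right _ _)
  have hbdd : BddAbove (Set.range fun t => f (min t a)) := by
    refine ⟨B, ?_⟩
    rintro _ ⟨t, rfl⟩
    exact hB _ (min_le_right _ _)
  refine ⟨_, (tendsto_atBot_ciSup hanti hbdd).congr'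
    ((eventually_le_atBot a).mono fun t ht => by simp only [min_eq_left ht]), fun t ht => ?_⟩
  have := le_ciSup hbdd t
  simpa only [min_eq_left ht] using this

theorem exists_tendsto_atBot_of_monotone {f : ℝ → ℝ} {a B : ℝ}
    (hf : ∀ s t, s ≤ t → t ≤ a → f s ≤ f t) (hB : ∀ t ≤ a, B ≤ f t) :
    ∃ m, Tendsto f atBot (𝓝 m) ∧ ∀ t ≤ a, m ≤ f t := by
  obtain ⟨m, h1, h2⟩ := exists_tendsto_atBot_of_antitone (f := fun t => -f t) (a := a) (B := -B)
    (fun s t hst ht => neg_le_neg (hf s t hst ht)) (fun t ht => neg_le_neg (hB t ht))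
  refine ⟨-m, ?_, fun t ht => by linarith [h2 t ht]⟩
  simpa using h1.neg

namespace IsLorenzSol

variable {σ ρ β : ℝ} {x y z : ℝ → ℝ} {I : Set ℝ}

theorem of_hasDerivAt {u : ℝ → ℝ × ℝ × ℝ}
    (h : ∀ t ∈ I, HasDerivAt u (lorenzRHS σ ρ β (u t)) t) :
    IsLorenzSol σ ρ β (fun t => (u t).1) (fun t => (u t).2.1) (fun t => (u t).2.2) I :=
  ⟨fun t ht => (h t ht).fst, fun t ht => (h t ht).snd.fst, fun t ht => (h t ht).snd.snd⟩

theorem of_x_const (hσ : 0 < σ) (hβ : 0 < β) (h : IsLorenzSol σ ρ β x y z Set.univ) {c M : ℝ}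
    (hx : ∀ t, x t = c) (hz : ∀ t, |z t| ≤ M) :
    y 0 = c ∧ ((c = 0 ∧ z 0 = 0) ∨ (c ≠ 0 ∧ c ^ 2 = β * (ρ - 1) ∧ z 0 = ρ - 1)) := by
  have hx' : x = fun _ => c := funext hx
  have hy : ∀ t, y t = c := by
    intro t
    have h1 := (h.hx t trivial).unique (by rw [hx']; exact hasDerivAt_const t c)
    have := (mul_eq_zero.1 h1).resolve_left hσ.ne'
    rw [hx t] at this
    linarith
  have hy' : y = fun _ => c := funext hy
  refine ⟨hy 0, ?_⟩
  by_cases hc : c = 0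
  · refine Or.inl ⟨hc, ?_⟩
    have h1 := nonpos_of_deriv_le_of_bounded (f := z) (a := 0) (B := M) hβ
      (fun t _ => h.hz t trivial) (fun t _ => by rw [hx, hc]; linarith)
      (fun t _ => (abs_le.1 (hz t)).2)
    have h2 := nonpos_of_deriv_le_of_bounded (f := fun t => -z t) (a := 0) (B := M) hβ
      (fun t _ => (h.hz t trivial).neg) (fun t _ => by rw [hx, hc]; linarith)
      (fun t _ => by linarith [(abs_le.1 (hz t)).1])
    linarith
  · have hz : ∀ t, z t = ρ - 1 := by
      intro t
      have h1 := (h.hy t trivial).unique (by rw [hy']; exact hasDerivAt_const t c)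
      rw [hx, hy] at h1
      have : c * (ρ - 1 - z t) = 0 := by linarith
      linarith [(mul_eq_zero.1 this).resolve_left hc]
    have hz' : z = fun _ => ρ - 1 := funext hz
    have h1 := (h.hz 0 trivial).unique (by rw [hz']; exact hasDerivAt_const 0 (ρ - 1))
    rw [hx, hy, hz] at h1
    exact Or.inr ⟨hc, by linarith, hz 0⟩

/-- A backward solution with `y ≤ x ≤ c` cannot emanate from the equilibrium `(c, c, ρ - 1)`. -/
theorem not_emanate (hβ : 0 < β) (h : IsLorenzSol σ ρ β x y z (Set.Iic 0)) {c M : ℝ}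
    (hc2 : c ^ 2 = β * (ρ - 1)) (hpos : ∀ t ≤ 0, 0 ≤ x t) (hxc : ∀ t ≤ 0, x t ≤ c)
    (hyx : ∀ t ≤ 0, y t ≤ x t) (hz : ∀ t ≤ 0, z t ≤ M) (hlim : Tendsto y atBot (𝓝 c)) :
    c ≤ x 0 := by
  have hzρ : ∀ t ≤ 0, z t ≤ ρ - 1 := by
    intro t ht
    have := nonpos_of_deriv_le_of_bounded (f := fun t => z t - (ρ - 1)) (a := t)
      (B := M - (ρ - 1)) hβ (fun s hs => (h.hz s (hs.trans ht)).sub_const (ρ - 1))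
      (fun s hs => by
        have h1 := mul_le_mul_of_nonneg_left (hyx s (hs.trans ht)) (hpos s (hs.trans ht))
        have h2 := mul_self_le_mul_self (hpos s (hs.trans ht)) (hxc s (hs.trans ht))
        linarith) (fun s hs => by linarith [hz s (hs.trans ht)])
    linarith
  have hy : ∀ t ≤ 0, y t ≤ y 0 := fun t ht =>
    le_of_deriv_nonneg ht (fun s hs => h.hy s hs.2) (fun s hs => by
      have h1 := mul_nonneg (hpos s hs.2.le) (sub_nonneg.2 (hzρ s hs.2.le))
      linarith [hyx s hs.2.le])
  have h1 := le_of_tendsto hlim ((eventually_le_atBot 0).mono hy)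
  exact h1.trans (hyx 0 le_rfl)

end IsLorenzSol

/-- A continuous family of flows agreeing with the Lorenz flows in the box of radius `M`. -/
structure IsLorenzFlow (σ β M : ℝ) (Φ : ℝ → ℝ × ℝ × ℝ → ℝ → ℝ × ℝ × ℝ) : Prop where
  cont : Continuous fun q : ℝ × (ℝ × ℝ × ℝ) × ℝ => Φ q.1 q.2.1 q.2.2
  zero : ∀ ρ p, Φ ρ p 0 = p
  add : ∀ ρ p s t, Φ ρ (Φ ρ p s) t = Φ ρ p (s + t)
  deriv : ∀ ρ p t, |ρ| ≤ M → ‖Φ ρ p t‖ ≤ M →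
    HasDerivAt (Φ ρ p) (lorenzRHS σ ρ β (Φ ρ p t)) t
  equil : ∀ ρ p, |ρ| ≤ M → ‖p‖ ≤ M → lorenzRHS σ ρ β p = 0 → ∀ t, Φ ρ p t = p

namespace IsLorenzFlow

variable {σ β M ρ : ℝ} {Φ : ℝ → ℝ × ℝ × ℝ → ℝ → ℝ × ℝ × ℝ} {q : ℝ × ℝ × ℝ}

theorem tendsto (hΦ : IsLorenzFlow σ β M Φ) {ι : Type*} {l : Filter ι} {r s : ι → ℝ}
    {p : ι → ℝ × ℝ × ℝ} {t : ℝ} (hr : Tendsto r l (𝓝 ρ)) (hp : Tendsto p l (𝓝 q))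
    (hs : Tendsto s l (𝓝 t)) : Tendsto (fun i => Φ (r i) (p i) (s i)) l (𝓝 (Φ ρ q t)) :=
  (hΦ.cont.tendsto (ρ, q, t)).comp (hr.prodMk_nhds (hp.prodMk_nhds hs))

theorem isLorenzSol (hΦ : IsLorenzFlow σ β M Φ) (hρ : |ρ| ≤ M) {I : Set ℝ}
    (hI : ∀ t ∈ I, ‖Φ ρ q t‖ ≤ M) : IsLorenzSol σ ρ β (fun t => (Φ ρ q t).1)
      (fun t => (Φ ρ q t).2.1) (fun t => (Φ ρ q t).2.2) I :=
  .of_hasDerivAt fun t ht => hΦ.deriv ρ q t hρ (hI t ht)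

/-- Limit orbits along an ultrafilter converging to `±∞`. -/
theorem exists_limit_orbit (hΦ : IsLorenzFlow σ β M Φ) {l : Filter ℝ}
    (hl : ∀ t, Tendsto (fun s => s + t) l l) (hbox : ∀ᶠ s in l, ‖Φ ρ q s‖ ≤ M)
    {𝒰 : Ultrafilter ℝ} (h𝒰 : (𝒰 : Filter ℝ) ≤ l) :
    ∃ w, Tendsto (Φ ρ q) 𝒰 (𝓝 w) ∧ (∀ t, Tendsto (fun s => Φ ρ q (s + t)) 𝒰 (𝓝 (Φ ρ w t))) ∧
      ∀ t, ‖Φ ρ w t‖ ≤ M := by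
  obtain ⟨w, -, hw⟩ := (isCompact_closedBall (0 : ℝ × ℝ × ℝ) M).ultrafilter_le_nhds'
    (𝒰.map (Φ ρ q)) ((hbox.filter_mono h𝒰).mono fun s hs => mem_closedBall_zero_iff.2 hs)
  have hw : Tendsto (Φ ρ q) 𝒰 (𝓝 w) := hw
  have h1 : ∀ t, Tendsto (fun s => Φ ρ q (s + t)) 𝒰 (𝓝 (Φ ρ w t)) := fun t =>
    (hΦ.tendsto tendsto_const_nhds hw tendsto_const_nhds).congr fun s => hΦ.add ρ q s t
  exact ⟨w, hw, h1, fun t => le_of_tendsto (h1 t).norm (((hl t).eventually hbox).filter_mono h𝒰)⟩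

/-- A bounded half-orbit along which `x` converges tends to an equilibrium. -/
theorem tendsto_equilibrium (hΦ : IsLorenzFlow σ β M Φ) (hσ : 0 < σ) (hβ : 0 < β)
    (hρ : |ρ| ≤ M) {l : Filter ℝ} [l.NeBot] (hl : ∀ t, Tendsto (fun s => s + t) l l)
    (hbox : ∀ᶠ s in l, ‖Φ ρ q s‖ ≤ M) {c : ℝ}
    (hx : Tendsto (fun s => (Φ ρ q s).1) l (𝓝 c)) :
    (c = 0 ∧ Tendsto (Φ ρ q) l (𝓝 0)) ∨
      (c ^ 2 = β * (ρ - 1) ∧ Tendsto (Φ ρ q) l (𝓝 (c, c, ρ - 1))) := by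
  have key : ∀ 𝒰 : Ultrafilter ℝ, (𝒰 : Filter ℝ) ≤ l →
      (c = 0 ∧ Tendsto (Φ ρ q) 𝒰 (𝓝 0)) ∨
      (c ≠ 0 ∧ c ^ 2 = β * (ρ - 1) ∧ Tendsto (Φ ρ q) 𝒰 (𝓝 (c, c, ρ - 1))) := by
    intro 𝒰 h𝒰
    obtain ⟨w, hw, hwt, hwM⟩ := hΦ.exists_limit_orbit hl hbox h𝒰
    have hxw : ∀ t, (Φ ρ w t).1 = c := fun t =>
      tendsto_nhds_unique (hwt t).fst_nhds ((hx.comp (hl t)).mono_left h𝒰)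
    obtain ⟨h1, h2⟩ := (hΦ.isLorenzSol hρ (fun t (_ : t ∈ Set.univ) => hwM t)).of_x_const hσ hβ hxw
      (fun t => (norm_triple_le_iff.1 (hwM t)).2.2)
    have hx0 := hxw 0
    rw [hΦ.zero] at h1 h2 hx0
    rcases h2 with ⟨hc, hz⟩ | ⟨hc, hc2, hz⟩
    · have : w = 0 := Prod.ext (hx0.trans hc) (Prod.ext (h1.trans hc) hz)
      exact Or.inl ⟨hc, this ▸ hw⟩
    · have : w = (c, c, ρ - 1) := Prod.ext hx0 (Prod.ext h1 hz)
      exact Or.inr ⟨hc, hc2, this ▸ hw⟩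
  by_cases hc : c = 0
  · refine Or.inl ⟨hc, tendsto_iff_ultrafilter _ _ _ |>.2 fun 𝒰 h𝒰 => ?_⟩
    exact ((key 𝒰 h𝒰).resolve_right fun h => h.1 hc).2
  · refine Or.inr ⟨?_, tendsto_iff_ultrafilter _ _ _ |>.2 fun 𝒰 h𝒰 => ?_⟩
    · exact ((key (Ultrafilter.of l) (Ultrafilter.of_le l)).resolve_left fun h => hc h.1).2.1
    · exact ((key 𝒰 h𝒰).resolve_left fun h => hc h.1).2.2

/-- A bounded backward orbit staying in `x ≥ c` is the equilibrium `(c, c, ρ - 1)`. -/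
theorem x_eq_of_le (hΦ : IsLorenzFlow σ β M Φ) (hσ : 0 < σ) (hβ : 0 < β) (h2 : β < 2 * σ)
    (hρ : |ρ| ≤ M) {c t₀ : ℝ} (hc : 0 < c) (hc2 : c ^ 2 = β * (ρ - 1)) (ht₀ : t₀ ≤ 0)
    (hbox : ∀ t ≤ 0, ‖Φ ρ q t‖ ≤ M) (hx : ∀ t ≤ t₀, c ≤ (Φ ρ q t).1) : q.1 = c := by
  have hM : 0 ≤ M := (abs_nonneg ρ).trans hρ
  have hsol := hΦ.isLorenzSol (q := q) hρ (I := Set.Iic 0) hbox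
  set x : ℝ → ℝ := fun t => (Φ ρ q t).1 with hxdef
  set y : ℝ → ℝ := fun t => (Φ ρ q t).2.1 with hydef
  set z : ℝ → ℝ := fun t => (Φ ρ q t).2.2 with hzdef
  have hM1 : ∀ t ≤ 0, |x t| ≤ M ∧ |y t| ≤ M ∧ |z t| ≤ M := fun t ht =>
    norm_triple_le_iff.1 (hbox t ht)
  have he : ∀ t ≤ t₀, σ * (ρ - 1 - z t) + (x t ^ 2 - c ^ 2) / 2 ≤ 0 := by
    intro t ht
    refine nonpos_of_deriv_le_of_bounded (f := fun t => σ * (ρ - 1 - z t) + (x t ^ 2 - c ^ 2) / 2)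
      (B := σ * (ρ - 1 + M) + M ^ 2 / 2) hβ
      (fun s hs => (((hsol.hz s (hs.trans (ht.trans ht₀))).const_sub (ρ - 1)).const_mul σ).add
        ((((hsol.hx s (hs.trans (ht.trans ht₀))).pow 2).sub_const (c ^ 2)).div_const 2))
      (fun s hs => ?_) (fun s hs => ?_)
    · have h3 : c ^ 2 ≤ x s ^ 2 := by gcongr; exact hx s (hs.trans ht)
      have h4 := mul_nonneg (by linarith : 0 ≤ σ - β / 2) (sub_nonneg.2 h3)
      have h5 : σ * c ^ 2 = σ * (β * (ρ - 1)) := by rw [hc2]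
      simp only [Nat.cast_ofNat, Nat.add_one_sub_one, pow_one]
      nlinarith
    · obtain ⟨h3, -, h5⟩ := hM1 s (hs.trans (ht.trans ht₀))
      have h6 : x s ^ 2 ≤ M ^ 2 := sq_le_sq' (abs_le.1 h3).1 (abs_le.1 h3).2
      have h7 := mul_le_mul_of_nonneg_left (abs_le.1 h5).1 hσ.le
      have h8 := sq_nonneg c
      nlinarith
  have hq : ∀ s t, s ≤ t → t ≤ t₀ → σ * y t + x t ≤ σ * y s + x s := by
    intro s t hst ht
    refine le_of_deriv_nonpos (f := fun t => σ * y t + x t) hst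
      (fun r hr => ((hsol.hy r (hr.2.trans (ht.trans ht₀))).const_mul σ).add
        (hsol.hx r (hr.2.trans (ht.trans ht₀)))) (fun r hr => ?_)
    have h3 := hx r (hr.2.le.trans ht)
    have h4 := he r (hr.2.le.trans ht)
    have h5 : c ^ 2 ≤ x r ^ 2 := by gcongr
    have h6 : x r * (σ * (ρ - 1 - z r)) ≤ 0 :=
      mul_nonpos_of_nonneg_of_nonpos (hc.le.trans h3) (by linarith)
    linarith
  obtain ⟨m, hm, hmle⟩ := exists_tendsto_atBot_of_antitone (f := fun t => σ * y t + x t)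
    (B := (σ + 1) * M)
    hq (fun t ht => by
      obtain ⟨h3, h4, -⟩ := hM1 t (ht.trans ht₀)
      have := mul_le_mul_of_nonneg_left (abs_le.1 h4).2 hσ.le
      linarith [(abs_le.1 h3).2])
  have hl : ∀ t : ℝ, Tendsto (fun s => s + t) atBot atBot := fun t =>
    tendsto_atBot_add_const_right _ t tendsto_id
  have hmc : m = (σ + 1) * c := by
    have h𝒰 := Ultrafilter.of_le (atBot : Filter ℝ)
    obtain ⟨w, -, hwt, hwM⟩ := hΦ.exists_limit_orbit (ρ := ρ) (q := q) hl
      ((eventually_le_atBot 0).mono hbox) h𝒰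
    have hwsol := hΦ.isLorenzSol (q := w) hρ (fun t (_ : t ∈ Set.univ) => hwM t)
    have hwx : ∀ t, Tendsto (fun s => x (s + t)) (Ultrafilter.of atBot : Ultrafilter ℝ)
      (𝓝 (Φ ρ w t).1) := fun t => (hwt t).fst_nhds
    have hwy : ∀ t, Tendsto (fun s => y (s + t)) (Ultrafilter.of atBot : Ultrafilter ℝ)
      (𝓝 (Φ ρ w t).2.1) := fun t => (hwt t).snd_nhds.fst_nhds
    have hwz : ∀ t, Tendsto (fun s => z (s + t)) (Ultrafilter.of atBot : Ultrafilter ℝ)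
      (𝓝 (Φ ρ w t).2.2) := fun t => (hwt t).snd_nhds.snd_nhds
    have hev : ∀ t, ∀ᶠ s in (Ultrafilter.of atBot : Ultrafilter ℝ), s + t ≤ t₀ := fun t =>
      ((hl t).eventually (eventually_le_atBot t₀)).filter_mono h𝒰
    have hwq : ∀ t, σ * (Φ ρ w t).2.1 + (Φ ρ w t).1 = m := fun t =>
      tendsto_nhds_unique (((hwy t).const_mul σ).add (hwx t)) ((hm.comp (hl t)).mono_left h𝒰)
    have hwc : ∀ t, c ≤ (Φ ρ w t).1 := fun t =>
      ge_of_tendsto (hwx t) ((hev t).mono fun s hs => hx _ hs)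
    have hwe : ∀ t, σ * (ρ - 1 - (Φ ρ w t).2.2) + ((Φ ρ w t).1 ^ 2 - c ^ 2) / 2 ≤ 0 := fun t =>
      le_of_tendsto ((((hwz t).const_sub (ρ - 1)).const_mul σ).add
        ((((hwx t).pow 2).sub_const (c ^ 2)).div_const 2)) ((hev t).mono fun s hs => he _ hs)
    have hwρ : ∀ t, (Φ ρ w t).2.2 = ρ - 1 := by
      intro t
      have h3 := (((hwsol.hy t trivial).const_mul σ).add (hwsol.hx t trivial)).unique
        (f := fun t => σ * (Φ ρ w t).2.1 + (Φ ρ w t).1)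
        (by rw [funext hwq]; exact hasDerivAt_const t m)
      have h4 : σ * (Φ ρ w t).1 * (ρ - 1 - (Φ ρ w t).2.2) = 0 := by linarith
      have h5 := (mul_eq_zero.1 h4).resolve_left (mul_pos hσ (hc.trans_le (hwc t))).ne'
      linarith
    have hwx' : ∀ t, (Φ ρ w t).1 = c := by
      intro t
      have h3 := hwe t
      rw [hwρ t] at h3
      nlinarith [hwc t]
    obtain ⟨h3, -⟩ := hwsol.of_x_const hσ hβ hwx'
      (fun t => (norm_triple_le_iff.1 (hwM t)).2.2)
    rw [← hwq 0, hwx', h3]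
    ring
  have hxc : ∀ t ≤ t₀, x t = c := by
    intro t ht
    refine le_antisymm ?_ (hx t ht)
    have := nonpos_of_deriv_le_of_bounded (f := fun t => x t - c) (a := t) (B := M) (k := σ + 1)
      (by linarith) (fun s hs => (hsol.hx s (hs.trans (ht.trans ht₀))).sub_const c)
      (fun s hs => by
        have := hmle s (hs.trans ht)
        rw [hmc] at this
        linarith)
      (fun s hs => by linarith [(abs_le.1 (hM1 s (hs.trans (ht.trans ht₀))).1).2])
    linarith
  have hyc : ∀ t < t₀, y t = c := by
    intro t ht
    have h3 := (hsol.hx t (ht.le.trans ht₀)).unique ((hasDerivAt_const t c).congr_of_eventuallyEq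
      ((eventually_le_nhds ht).mono hxc))
    have := (mul_eq_zero.1 h3).resolve_left hσ.ne'
    linarith [hxc t ht.le]
  have hzc : z (t₀ - 1) = ρ - 1 := by
    have ht : t₀ - 1 < t₀ := by linarith
    have h3 := (hsol.hy _ (ht.le.trans ht₀)).unique ((hasDerivAt_const _ c).congr_of_eventuallyEq
      ((eventually_lt_nhds ht).mono hyc))
    rw [hxc _ ht.le, hyc _ ht] at h3
    have : c * (ρ - 1 - z (t₀ - 1)) = 0 := by linarith
    linarith [(mul_eq_zero.1 this).resolve_left hc.ne']
  have hpt : Φ ρ q (t₀ - 1) = (c, c, ρ - 1) :=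
    Prod.ext (hxc _ (by linarith)) (Prod.ext (hyc _ (by linarith)) hzc)
  have h4 := hΦ.add ρ q (t₀ - 1) (-(t₀ - 1))
  rw [hpt, add_neg_cancel, hΦ.zero, hΦ.equil ρ _ hρ (hpt ▸ hbox _ (by linarith)) (by
    simp only [lorenzRHS, Prod.mk_eq_zero]
    refine ⟨by ring, by ring, by linarith⟩)] at h4
  rw [← h4]

end IsLorenzFlow

theorem exists_tendsto_atTop_of_antitone {f : ℝ → ℝ} {a B : ℝ}
    (hf : ∀ s t, a ≤ s → s ≤ t → f t ≤ f s) (hB : ∀ t, a ≤ t → B ≤ f t) :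
    ∃ m, Tendsto f atTop (𝓝 m) ∧ ∀ t, a ≤ t → m ≤ f t := by
  obtain ⟨m, h1, h2⟩ := exists_tendsto_atBot_of_monotone (f := fun t => f (-t)) (a := -a) (B := B)
    (fun s t hst ht => hf _ _ (by linarith) (by linarith)) (fun t ht => hB _ (by linarith))
  refine ⟨m, ?_, fun t ht => ?_⟩
  · simpa [Function.comp_def] using h1.comp tendsto_neg_atTop_atBot
  · simpa using h2 (-t) (by linarith)

namespace IsLorenzFlow

variable {σ β M : ℝ} {Φ : ℝ → ℝ × ℝ × ℝ → ℝ → ℝ × ℝ × ℝ}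

theorem exists_homoclinic (hΦ : IsLorenzFlow σ β M Φ) (hσ : 0 < σ) (hβ : 0 < β) (h2 : β < 2 * σ)
    {δ ρ₀ ρ₁ : ℝ} (hδ : 0 < δ) (hδρ : δ ^ 2 < β * (ρ₀ - 1)) (hρ₁ : ρ₁ ≤ M) {r : ℕ → ℝ}
    {p : ℕ → ℝ × ℝ × ℝ} (hr : ∀ n, r n ∈ Set.Icc ρ₀ ρ₁) (hp : Tendsto p atTop (𝓝 0))
    (hbox : ∀ n t, 0 ≤ t → ‖Φ (r n) (p n) t‖ ≤ M)
    (hpass : ∀ n : ℕ, ∃ a t₁ b, IsPassage (√(β * (r n - 1))) δ n (fun t => (Φ (r n) (p n) t).1)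
      (fun t => (Φ (r n) (p n) t).2.1) a t₁ b) :
    ∃ ρ : ℝ, 1 < ρ ∧ ∃ u : ℝ → ℝ × ℝ × ℝ,
      (∀ t : ℝ, HasDerivAt u (lorenzRHS σ ρ β (u t)) t) ∧
      (∃ t₁ t₂ : ℝ, u t₁ ≠ u t₂) ∧ Tendsto u atTop (𝓝 0) ∧ Tendsto u atBot (𝓝 0) := by
  choose a t₁ b hab using hpass
  have hρ₀ : 1 < ρ₀ := by
    have : 0 < β * (ρ₀ - 1) := (by positivity : 0 ≤ δ ^ 2).trans_lt hδρ
    linarith [pos_of_mul_pos_right this hβ.le]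
  have h𝒰 : (hyperfilter ℕ : Filter ℕ) ≤ atTop := Nat.hyperfilter_le_atTop
  obtain ⟨ρ, hρm, hρ⟩ := (isCompact_Icc (a := ρ₀) (b := ρ₁)).ultrafilter_le_nhds'
    ((hyperfilter ℕ).map r) (Ultrafilter.mem_map.2 (Eventually.of_forall hr))
  have hρ : Tendsto r (hyperfilter ℕ) (𝓝 ρ) := hρ
  have hρM : |ρ| ≤ M := abs_le.2 ⟨by linarith [hρm.1, hρm.2], hρm.2.trans hρ₁⟩
  have hM : 0 ≤ M := (abs_nonneg ρ).trans hρM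
  obtain ⟨q, -, hq⟩ := (isCompact_closedBall (0 : ℝ × ℝ × ℝ) M).ultrafilter_le_nhds'
    ((hyperfilter ℕ).map fun n => Φ (r n) (p n) (b n))
    (Ultrafilter.mem_map.2 (Eventually.of_forall fun n => mem_closedBall_zero_iff.2
      (hbox n _ ((hab n).pos.trans (hab n).le))))
  have hq : Tendsto (fun n => Φ (r n) (p n) (b n)) (hyperfilter ℕ) (𝓝 q) := hq
  have hv : ∀ t, Tendsto (fun n => Φ (r n) (p n) (b n + t)) (hyperfilter ℕ) (𝓝 (Φ ρ q t)) :=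
    fun t => (hΦ.tendsto hρ hq tendsto_const_nhds).congr fun n => hΦ.add _ _ _ _
  set c : ℝ := √(β * (ρ - 1)) with hc
  have hcn : Tendsto (fun n => √(β * (r n - 1))) (hyperfilter ℕ) (𝓝 c) :=
    ((hρ.sub_const 1).const_mul β).sqrt
  have hβρ : β * (ρ₀ - 1) ≤ β * (ρ - 1) := by gcongr; exact hρm.1
  have hδc : δ < c := (Real.lt_sqrt hδ.le).2 (hδρ.trans_le hβρ)
  have hc0 : 0 < c := hδ.trans hδc
  have hc2 : c ^ 2 = β * (ρ - 1) := Real.sq_sqrt (mul_nonneg hβ.le (by linarith [hρm.1]))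
  have ha : ∀ K, ∀ᶠ n in (hyperfilter ℕ : Filter ℕ), K < a n := by
    intro K
    by_contra hcon
    rw [← Ultrafilter.eventually_not] at hcon
    obtain ⟨s, -, hs⟩ := (isCompact_Icc (a := (0 : ℝ)) (b := K)).ultrafilter_le_nhds'
      ((hyperfilter ℕ).map a) (hcon.mono fun n hn => ⟨(hab n).pos, not_lt.1 hn⟩)
    have hs : Tendsto a (hyperfilter ℕ) (𝓝 s) := hs
    have h3 := (hΦ.tendsto hρ (hp.mono_left h𝒰) hs).fst_nhds
    rw [hΦ.equil ρ 0 hρM (by simpa using hM) (by simp [lorenzRHS])] at h3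
    have h4 : Tendsto (fun n => (Φ (r n) (p n) (a n)).1) (hyperfilter ℕ) (𝓝 δ) :=
      tendsto_const_nhds.congr fun n => (hab n).xa.symm
    exact hδ.ne (tendsto_nhds_unique h3 h4)
  have hb : ∀ t, ∀ᶠ n in (hyperfilter ℕ : Filter ℕ), 0 ≤ b n + t := fun t =>
    (ha (-t)).mono fun n hn => by linarith [(hab n).le]
  have hvM : ∀ t, ‖Φ ρ q t‖ ≤ M := fun t =>
    le_of_tendsto (hv t).norm ((hb t).mono fun n hn => hbox n _ hn)
  have hsol := hΦ.isLorenzSol (q := q) hρM (fun t (_ : t ∈ Set.univ) => hvM t)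
  set x : ℝ → ℝ := fun t => (Φ ρ q t).1 with hx
  set y : ℝ → ℝ := fun t => (Φ ρ q t).2.1 with hy
  set z : ℝ → ℝ := fun t => (Φ ρ q t).2.2 with hz
  have hX : ∀ t, Tendsto (fun n => (Φ (r n) (p n) (b n + t)).1) (hyperfilter ℕ) (𝓝 (x t)) :=
    fun t => (hv t).fst_nhds
  have hY : ∀ t, Tendsto (fun n => (Φ (r n) (p n) (b n + t)).2.1) (hyperfilter ℕ) (𝓝 (y t)) :=
    fun t => (hv t).snd_nhds.fst_nhds
  have hqδ : q.1 = δ := tendsto_nhds_unique hq.fst_nhds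
    (tendsto_const_nhds.congr fun n => (hab n).xh.symm)
  have hx0 : x 0 = δ := by rw [hx]; simp only [hΦ.zero]; exact hqδ
  have hbot : ∀ t : ℝ, Tendsto (fun s => s + t) atBot atBot := fun t =>
    tendsto_atBot_add_const_right _ t tendsto_id
  have htop : ∀ t : ℝ, Tendsto (fun s => s + t) atTop atTop := fun t =>
    tendsto_atTop_add_const_right _ t tendsto_id
  have hbound : ∀ t, -M ≤ x t ∧ x t ≤ M := fun t => abs_le.1 (norm_triple_le_iff.1 (hvM t)).1
  have hz0 : ∀ l : Filter ℝ, l.NeBot → (∀ t, Tendsto (fun s => s + t) l l) → ∀ m, m ≤ δ →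
      -δ ≤ m → Tendsto x l (𝓝 m) → Tendsto (Φ ρ q) l (𝓝 0) := by
    intro l _ hl m hm hm' hlim
    rcases hΦ.tendsto_equilibrium hσ hβ hρM hl (Eventually.of_forall hvM) hlim with h3 | h3
    · exact h3.2
    · nlinarith [h3.1]
  have hpos : ∀ m, 0 < m → Tendsto x atBot (𝓝 m) →
      m ^ 2 = β * (ρ - 1) ∧ Tendsto (Φ ρ q) atBot (𝓝 (m, m, ρ - 1)) := by
    intro m hm hlim
    exact (hΦ.tendsto_equilibrium hσ hβ hρM hbot (Eventually.of_forall hvM) hlim).resolve_left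
      fun h3 => hm.ne' h3.1
  by_cases hC : ∃ K, ∀ᶠ n in (hyperfilter ℕ : Filter ℕ), b n - a n ≤ K
  · obtain ⟨K, hK⟩ := hC
    have hright : ∀ t, 0 ≤ t → 0 ≤ x t ∧ x t ≤ δ ∧ y t ≤ x t := by
      intro t ht
      have hev : ∀ᶠ n in (hyperfilter ℕ : Filter ℕ), b n + t ∈ Set.Icc (b n) (a n + n) := by
        have hn : ∀ᶠ n : ℕ in (hyperfilter ℕ : Filter ℕ), t + K ≤ n :=
          (tendsto_natCast_atTop_atTop.eventually (eventually_ge_atTop (t + K))).filter_mono h𝒰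
        filter_upwards [hK, hn] with n h3 h4
        exact ⟨by linarith, by linarith⟩
      exact ⟨ge_of_tendsto (hX t) (hev.mono fun n hn => ((hab n).decay _ hn).1),
        le_of_tendsto (hX t) (hev.mono fun n hn => ((hab n).decay _ hn).2.1),
        le_of_tendsto_of_tendsto (hY t) (hX t) (hev.mono fun n hn => ((hab n).decay _ hn).2.2)⟩
    have hleft : ∀ t ≤ -K, 0 ≤ x t ∧ x t ≤ δ ∧ x t ≤ y t := by
      intro t ht
      have hev : ∀ᶠ n in (hyperfilter ℕ : Filter ℕ), b n + t ∈ Set.Icc 0 (a n) := by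
        filter_upwards [hK, hb t] with n h3 h4
        exact ⟨h4, by linarith⟩
      exact ⟨ge_of_tendsto (hX t) (hev.mono fun n hn => ((hab n).rise _ hn).1),
        le_of_tendsto (hX t) (hev.mono fun n hn => ((hab n).rise _ hn).2.1),
        le_of_tendsto_of_tendsto (hX t) (hY t) (hev.mono fun n hn => ((hab n).rise _ hn).2.2)⟩
    obtain ⟨m, hm, hmle⟩ := exists_tendsto_atTop_of_antitone (f := x) (a := 0) (B := 0)
      (fun s t hs hst => le_of_deriv_nonpos hst (fun u _ => hsol.hx u trivial) (fun u hu =>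
        mul_nonpos_of_nonneg_of_nonpos hσ.le (by linarith [(hright u (hs.trans hu.1.le)).2.2])))
      (fun t ht => (hright t ht).1)
    have hm0 : 0 ≤ m := ge_of_tendsto hm ((eventually_ge_atTop 0).mono fun t ht => (hright t ht).1)
    have hlimtop := hz0 atTop inferInstance htop m ((hmle 0 le_rfl).trans hx0.le) (by linarith) hm
    obtain ⟨m', hm', hmle'⟩ := exists_tendsto_atBot_of_monotone (f := x) (a := -K) (B := 0)
      (fun s t hst ht => le_of_deriv_nonneg hst (fun u _ => hsol.hx u trivial) (fun u hu =>
        mul_nonneg hσ.le (by linarith [(hleft u (hu.2.le.trans ht)).2.2])))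
      (fun t ht => (hleft t ht).1)
    have hm0' : 0 ≤ m' :=
      ge_of_tendsto hm' ((eventually_le_atBot (-K)).mono fun t ht => (hleft t ht).1)
    have hlimbot := hz0 atBot inferInstance hbot m'
      ((hmle' (-K) le_rfl).trans (hleft (-K) le_rfl).2.1) (by linarith) hm'
    refine ⟨ρ, hρ₀.trans_le hρm.1, Φ ρ q, fun t => hΦ.deriv ρ q t hρM (hvM t), ?_, hlimtop, hlimbot⟩
    by_contra! hconst
    have h3 : Tendsto x atTop (𝓝 0) := hlimtop.fst_nhds
    have h4 : Tendsto x atTop (𝓝 δ) := tendsto_const_nhds.congr fun t => by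
      rw [← hx0]; exact congrArg Prod.fst (hconst 0 t)
    exact hδ.ne (tendsto_nhds_unique h3 h4)
  · exfalso
    have hC : ∀ K, ∀ᶠ n in (hyperfilter ℕ : Filter ℕ), K < b n - a n := fun K => by
      have := Ultrafilter.eventually_not.2 fun h => hC ⟨K, h⟩
      exact this.mono fun n hn => not_le.1 hn
    have hxδ : ∀ t ≤ 0, δ ≤ x t := fun t ht =>
      ge_of_tendsto (hX t) ((hC (-t)).mono fun n hn =>
        (hab n).above _ ⟨by linarith, by linarith⟩)
    have hfreq : ∀ t₀ ≤ 0, ∃ t ≤ t₀, x t < c := by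
      intro t₀ ht₀
      by_contra! hcon
      have := hΦ.x_eq_of_le hσ hβ h2 hρM hc0 hc2 ht₀ (fun t _ => hvM t) hcon
      linarith
    by_cases hD : ∃ K, ∀ᶠ n in (hyperfilter ℕ : Filter ℕ), b n - t₁ n ≤ K
    · obtain ⟨K, hK⟩ := hD
      have hup : ∀ t ≤ -K, x t ≤ y t ∨ c ≤ x t := by
        intro t ht
        have hev : ∀ᶠ n in (hyperfilter ℕ : Filter ℕ), b n + t ∈ Set.Icc 0 (t₁ n) := by
          filter_upwards [hK, hb t] with n h3 h4
          exact ⟨h4, by linarith⟩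
        rcases Ultrafilter.eventually_or.1 (hev.mono fun n hn => (hab n).up _ hn) with h3 | h3
        · exact Or.inl (le_of_tendsto_of_tendsto (hX t) (hY t) h3)
        · exact Or.inr (le_of_tendsto_of_tendsto hcn (hX t) h3)
      obtain ⟨t₀, ht₀, hxt₀⟩ := hfreq (min (-K) 0) (min_le_right _ _)
      have hK₀ : t₀ ≤ -K := ht₀.trans (min_le_left _ _)
      have h0₀ : t₀ ≤ 0 := ht₀.trans (min_le_right _ _)
      have hmono : ∀ s ≤ t₀, x s ≤ x t₀ := fun s hs =>
        (hsol.mono (Set.subset_univ _)).x_le_right hσ hs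
          (fun t ht => hup t (ht.2.trans hK₀)) hxt₀
      obtain ⟨m, hm, hmle⟩ := exists_tendsto_atBot_of_monotone (f := x) (a := t₀) (B := δ)
        (fun s t hst ht => (hsol.mono (Set.subset_univ _)).x_le_right hσ hst
          (fun u hu => hup u (hu.2.trans (ht.trans hK₀))) ((hmono t ht).trans_lt hxt₀))
        (fun t ht => hxδ t (ht.trans h0₀))
      have hmδ : δ ≤ m := ge_of_tendsto hm ((eventually_le_atBot 0).mono hxδ)
      have h3 := (hpos m (hδ.trans_le hmδ) hm).1
      nlinarith [hmle t₀ le_rfl]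
    · have hD : ∀ K, ∀ᶠ n in (hyperfilter ℕ : Filter ℕ), K < b n - t₁ n := fun K => by
        have := Ultrafilter.eventually_not.2 fun h => hD ⟨K, h⟩
        exact this.mono fun n hn => not_le.1 hn
      have hdown : ∀ t ≤ 0, y t ≤ x t ∨ c ≤ x t := by
        intro t ht
        have hev : ∀ᶠ n in (hyperfilter ℕ : Filter ℕ), b n + t ∈ Set.Icc (t₁ n) (b n) :=
          (hD (-t)).mono fun n hn => ⟨by linarith, by linarith⟩
        rcases Ultrafilter.eventually_or.1 (hev.mono fun n hn => (hab n).down _ hn) with h3 | h3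
        · exact Or.inl (le_of_tendsto_of_tendsto (hY t) (hX t) h3)
        · exact Or.inr (le_of_tendsto_of_tendsto hcn (hX t) h3)
      have hxc : ∀ t ≤ 0, x t < c := by
        intro t ht
        obtain ⟨s, hs, hxs⟩ := hfreq t ht
        exact ((hsol.mono (Set.subset_univ _)).x_le_left hσ hs
          (fun u hu => hdown u (hu.2.trans ht)) hxs).trans_lt hxs
      obtain ⟨m, hm, hmle⟩ := exists_tendsto_atBot_of_antitone (f := x) (a := 0) (B := c)
        (fun s t hst ht => (hsol.mono (Set.subset_univ _)).x_le_left hσ hst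
          (fun u hu => hdown u (hu.2.trans ht)) (hxc s (hst.trans ht)))
        (fun t ht => (hxc t ht).le)
      have hm0 : 0 < m := hδ.trans_le (hx0 ▸ hmle 0 le_rfl)
      obtain ⟨h3, h4⟩ := hpos m hm0 hm
      have hmc : m = c := by
        rw [hc, ← h3, Real.sqrt_sq hm0.le]
      have := (hsol.mono (Set.subset_univ (Set.Iic 0))).not_emanate hβ hc2
        (fun t ht => hδ.le.trans (hxδ t ht)) (fun t ht => (hxc t ht).le)
        (fun t ht => (hdown t ht).resolve_right (not_le.2 (hxc t ht)))
        (fun t _ => (abs_le.1 (norm_triple_le_iff.1 (hvM t)).2.2).2)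
        (hmc ▸ h4.snd_nhds.fst_nhds)
      linarith

end IsLorenzFlow

/-- The value of `ρ` for which `l` is the positive eigenvalue of `η² + (σ + 1) η = σ (ρ - 1)`. -/
noncomputable def rhoOf (σ l : ℝ) : ℝ := 1 + l * (l + σ + 1) / σ

/-- A point close to the unstable manifold of the origin. -/
noncomputable def startPoint (σ l ε : ℝ) : ℝ × ℝ × ℝ := (ε, (1 + l / σ) * ε, ε ^ 2 / (2 * σ))

theorem rhoOf_spec {σ : ℝ} (hσ : 0 < σ) (l : ℝ) : l ^ 2 + (σ + 1) * l = σ * (rhoOf σ l - 1) := by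
  simp only [rhoOf]
  field_simp
  ring

theorem rhoOf_mono {σ l l' : ℝ} (hσ : 0 < σ) (hl : 0 ≤ l) (h : l ≤ l') :
    rhoOf σ l ≤ rhoOf σ l' := by
  simp only [rhoOf]
  gcongr
  linarith

theorem one_lt_rhoOf {σ l : ℝ} (hσ : 0 < σ) (hl : 0 < l) : 1 < rhoOf σ l := by
  have : 0 < l * (l + σ + 1) / σ := by positivity
  simp only [rhoOf]
  linarith

theorem continuous_rhoOf (σ : ℝ) : Continuous (rhoOf σ) := by
  unfold rhoOf
  fun_prop

theorem continuous_startPoint (σ ε : ℝ) : Continuous fun l => startPoint σ l ε := by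
  unfold startPoint
  fun_prop

namespace IsLorenzFlow

variable {σ β M : ℝ} {Φ : ℝ → ℝ × ℝ × ℝ → ℝ → ℝ × ℝ × ℝ}

theorem norm_le_of_trapped (hΦ : IsLorenzFlow σ β M Φ) (hβ : 0 < β) {m L ρ : ℝ}
    {q : ℝ × ℝ × ℝ} (hm : 0 < m) (hmσ : m ≤ 2 * σ) (hm2 : m ≤ 2) (hmβ : m ≤ β)
    (hL : 1 + β / m ≤ L) (hσρ : 0 ≤ σ + ρ) (hρ : |ρ| ≤ M) (hK : (1 + L) * (σ + ρ) < M)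
    (hq : q.1 ^ 2 + q.2.1 ^ 2 + (q.2.2 - (σ + ρ)) ^ 2 ≤ (L * (σ + ρ)) ^ 2) {t : ℝ} (ht : 0 ≤ t) :
    ‖Φ ρ q t‖ ≤ (1 + L) * (σ + ρ) := by
  have hL0 : 0 ≤ L := by
    have : 0 < β / m := div_pos hβ hm
    linarith
  have key : ∀ w : ℝ × ℝ × ℝ,
      w.1 ^ 2 + w.2.1 ^ 2 + (w.2.2 - (σ + ρ)) ^ 2 ≤ (L * (σ + ρ)) ^ 2 →
      ‖w‖ ≤ (1 + L) * (σ + ρ) := by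
    intro w hw
    have hr : 0 ≤ L * (σ + ρ) := mul_nonneg hL0 hσρ
    have h1 := abs_le_of_sq_le_sq (a := w.1) (by nlinarith) hr
    have h2 := abs_le_of_sq_le_sq (a := w.2.1) (by nlinarith) hr
    have h3 := abs_le.1 (abs_le_of_sq_le_sq (a := w.2.2 - (σ + ρ)) (by nlinarith) hr)
    exact norm_triple_le_iff.2 ⟨by linarith, by linarith,
      abs_le.2 ⟨by linarith, by linarith⟩⟩
  have hstep : ∀ s, 0 ≤ s → (∀ r ∈ Set.Icc 0 s, ‖Φ ρ q r‖ ≤ M) →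
      ‖Φ ρ q s‖ ≤ (1 + L) * (σ + ρ) := by
    intro s hs hM
    refine key _ ((hΦ.isLorenzSol hρ hM).trapping hβ hm hmσ hm2 hmβ hL hs ?_)
    simpa only [hΦ.zero] using hq
  have hlt : ∀ s, 0 ≤ s → ‖Φ ρ q s‖ < M := by
    intro s hs
    by_contra! hcon
    have hcont : Continuous fun r => ‖Φ ρ q r‖ :=
      (hΦ.cont.comp (by fun_prop : Continuous fun r : ℝ => (ρ, q, r))).norm
    obtain ⟨r, hr0, -, hr, hrlt⟩ := exists_first_eq hs hcont.continuousOn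
      (by rw [hΦ.zero]; exact (key q hq).trans_lt hK) hcon
    have := hstep r hr0.le (fun u hu => by
      rcases eq_or_lt_of_le hu.2 with h | h
      · rw [h, hr]
      · exact (hrlt u hu.1 h).le)
    linarith
  exact hstep t ht fun r hr => (hlt r hr.1).le

theorem exists_isPassage (hΦ : IsLorenzFlow σ β M Φ) (hσ : 0 < σ) (hβ : 0 < β)
    (hσβ : 2 * β + 1 < 3 * σ) {μ κ Z l₀ l₁ ε δ : ℝ} (hμ : μ = (3 * σ - 1 - 2 * β) / 2)
    (hκ : κ = 1 - β / (2 * σ)) (hl₀ : 0 < l₀) (hl : l₀ ≤ l₁) (hε : 0 < ε) (hεδ : ε < δ)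
    (hδ : δ ^ 2 < β * (rhoOf σ l₀ - 1))
    (hk : (σ + 4 / β - 2 / σ) ^ 2 * (rhoOf σ l₀ - 1) ≤ 4 * (σ + 1))
    (hG : ε ^ 2 * (σ / (4 * β) + (1 / β - 1 / (2 * σ)) ^ 2) < (σ + 1) * l₀ / 2)
    (hρM : rhoOf σ l₁ ≤ M) (hZM : Z ≤ M)
    (htrap : ∀ l ∈ Set.Icc l₀ l₁, ∀ t, 0 ≤ t → ‖Φ (rhoOf σ l) (startPoint σ l ε) t‖ ≤ Z)
    (hW : (β + μ) * ((4 * κ * (β + μ) / β + 4 * κ) * l₁ + κ * σ * Z / l₁)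
      < μ * (rhoOf σ l₁ - 1)) (N : ℝ) :
    ∃ l ∈ Set.Icc l₀ l₁, ∃ a t₁ b, IsPassage (√(β * (rhoOf σ l - 1))) δ N
      (fun t => (Φ (rhoOf σ l) (startPoint σ l ε) t).1)
      (fun t => (Φ (rhoOf σ l) (startPoint σ l ε) t).2.1) a t₁ b := by
  have h2 : β < 2 * σ := by linarith
  have hδ0 : 0 < δ := hε.trans hεδ
  have hcontΦ : Continuous fun q : ℝ × ℝ => Φ (rhoOf σ q.1) (startPoint σ q.1 ε) q.2 :=
    hΦ.cont.comp (((continuous_rhoOf σ).comp continuous_fst).prodMk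
      (((continuous_startPoint σ ε).comp continuous_fst).prodMk continuous_snd))
  have hρ : ∀ l ∈ Set.Icc l₀ l₁, |rhoOf σ l| ≤ M := fun l hlm => by
    have h3 := one_lt_rhoOf hσ (hl₀.trans_le hlm.1)
    rw [abs_of_pos (by linarith)]
    exact (rhoOf_mono hσ (hl₀.le.trans hlm.1) hlm.2).trans hρM
  have hsol : ∀ l ∈ Set.Icc l₀ l₁, IsLorenzSol σ (rhoOf σ l) β
      (fun t => (Φ (rhoOf σ l) (startPoint σ l ε) t).1)
      (fun t => (Φ (rhoOf σ l) (startPoint σ l ε) t).2.1)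
      (fun t => (Φ (rhoOf σ l) (startPoint σ l ε) t).2.2) (Set.Ici 0) := fun l hlm =>
    hΦ.isLorenzSol (hρ l hlm) (fun t ht => (htrap l hlm t ht).trans hZM)
  have hδc : ∀ l ∈ Set.Icc l₀ l₁, δ < √(β * (rhoOf σ l - 1)) := fun l hlm => by
    refine (Real.lt_sqrt hδ0.le).2 (hδ.trans_le ?_)
    have := rhoOf_mono hσ hl₀.le hlm.1
    gcongr
  have hc2 : ∀ l ∈ Set.Icc l₀ l₁, √(β * (rhoOf σ l - 1)) ^ 2 = β * (rhoOf σ l - 1) :=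
    fun l hlm => Real.sq_sqrt (mul_nonneg hβ.le
      (by linarith [one_lt_rhoOf hσ (hl₀.trans_le hlm.1)]))
  have hxy0 : ∀ l ∈ Set.Icc l₀ l₁, ε < (1 + l / σ) * ε := fun l hlm => by
    have : 0 < l / σ * ε := mul_pos (div_pos (hl₀.trans_le hlm.1) hσ) hε
    linarith
  have hz0 : ε ^ 2 / (2 * σ) < ε ^ 2 / β := by gcongr
  have hl₀m : l₀ ∈ Set.Icc l₀ l₁ := ⟨le_rfl, hl⟩
  have hl₁m : l₁ ∈ Set.Icc l₀ l₁ := ⟨hl, le_rfl⟩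
  have hg : 0 < rhoOf σ l₀ - 1 - δ ^ 2 / β := by
    rw [sub_pos, div_lt_iff₀ hβ]
    linarith
  have hdescent := exists_late_descent
    (X := fun l t => (Φ (rhoOf σ l) (startPoint σ l ε) t).1)
    (Y := fun l t => (Φ (rhoOf σ l) (startPoint σ l ε) t).2.1)
    (c := fun l => √(β * (rhoOf σ l - 1))) hcontΦ.fst hcontΦ.snd.fst
    (((continuous_rhoOf σ).sub continuous_const).const_mul β).sqrt hl
  specialize hdescent ?_ ?_ ?_
    ((σ + 1) * Z / (σ * ε * (rhoOf σ l₀ - 1 - δ ^ 2 / β)) + N)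
  · intro l hlm t₁ T hw
    refine (hsol l hlm).exists_isDescent hσ hβ hσβ (hδ0.trans (hδc l hlm)) (hc2 l hlm)
      ?_ ?_ ?_ ?_ hw
    · simpa only [hΦ.zero, startPoint] using hε
    · simpa only [hΦ.zero, startPoint] using hεδ.trans (hδc l hlm)
    · simpa only [hΦ.zero, startPoint] using hxy0 l hlm
    · simpa only [hΦ.zero, startPoint] using hz0
  · intro t₁ T hd
    have hT : 0 ≤ T := hd.nonneg.trans hd.le
    obtain ⟨s, hs0, -, hs, -⟩ := exists_first_eq
      (f := fun t => -(Φ (rhoOf σ l₀) (startPoint σ l₀ ε) t).1) (m := 0) hT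
      (fun t ht => ((hsol l₀ hl₀m).hx t ht.1).continuousAt.neg.continuousWithinAt)
      (by simpa only [hΦ.zero, startPoint] using neg_neg_of_pos hε) (neg_nonneg.2 hd.neg.le)
    refine (hsol l₀ hl₀m).ne_zero_of_energy_neg hσ hβ hk ?_ hs0.le (neg_eq_zero.1 hs)
    simp only [hΦ.zero, startPoint]
    have h3 : (σ * ((1 + l₀ / σ) * ε - ε)) ^ 2 / 2 - σ * (rhoOf σ l₀ - 1) * ε ^ 2 / 2
        + σ / (4 * β) * ε ^ 4 + (ε ^ 2 / β - ε ^ 2 / (2 * σ)) ^ 2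
        = ε ^ 2 * (ε ^ 2 * (σ / (4 * β) + (1 / β - 1 / (2 * σ)) ^ 2) - (σ + 1) * l₀ / 2) := by
      rw [← rhoOf_spec hσ]
      field_simp
      ring
    rw [h3]
    exact mul_neg_of_pos_of_neg (by positivity) (by linarith)
  · refine (hsol l₁ hl₁m).exists_isWeakDescent hσ hβ hσβ hμ hκ ?_ (hl₀.trans_le hl)
      (rhoOf_spec hσ l₁) ?_ ?_ (fun t ht =>
        (abs_le.1 (norm_triple_le_iff.1 (htrap l₁ hl₁m t ht)).2.2).2) hW _
    · simpa only [hΦ.zero, startPoint] using hε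
    · simp only [hΦ.zero, startPoint]
      field_simp
      ring
    · simp only [hΦ.zero, startPoint]
  obtain ⟨l, hlm, hex, hlate⟩ := hdescent
  refine ⟨l, hlm, (hsol l hlm).exists_isPassage (N := N) (R := Z) hσ hβ h2 ?_ ?_ ?_ ?_
    (hδc l hlm) hg ?_ ?_ hex ?_⟩
  · simpa only [hΦ.zero, startPoint] using hε
  · simpa only [hΦ.zero, startPoint] using hεδ
  · simpa only [hΦ.zero, startPoint] using hε.trans (hxy0 l hlm)
  · simpa only [hΦ.zero, startPoint] using hz0
  · linarith [rhoOf_mono hσ hl₀.le hlm.1]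
  · intro t ht
    obtain ⟨h3, h4, -⟩ := norm_triple_le_iff.1 (htrap l hlm t ht)
    exact ⟨(abs_le.1 h3).2, (abs_le.1 h4).2⟩
  · simpa only [hΦ.zero, startPoint] using hlate

end IsLorenzFlow

theorem startPoint_trapped {σ L ρ l l₁ ε : ℝ} (hσ : 0 < σ) (hL : 2 ≤ L) (hρ : 1 ≤ ρ) (hl : 0 ≤ l)
    (hll : l ≤ l₁) (h1 : ε ^ 2 / (2 * σ) ≤ 1) (h2 : ε ^ 2 * (1 + (1 + l₁ / σ) ^ 2) ≤ 1) :
    (startPoint σ l ε).1 ^ 2 + (startPoint σ l ε).2.1 ^ 2 +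
      ((startPoint σ l ε).2.2 - (σ + ρ)) ^ 2 ≤ (L * (σ + ρ)) ^ 2 := by
  simp only [startPoint]
  have h3 : ε ^ 2 * (1 + (1 + l / σ) ^ 2) ≤ ε ^ 2 * (1 + (1 + l₁ / σ) ^ 2) := by gcongr
  have h4 : 0 ≤ ε ^ 2 / (2 * σ) := by positivity
  have h5 : (ε ^ 2 / (2 * σ) - (σ + ρ)) ^ 2 ≤ (σ + ρ) ^ 2 :=
    sq_le_sq' (by linarith) (by linarith)
  have h6 : (2 * (σ + ρ)) ^ 2 ≤ (L * (σ + ρ)) ^ 2 := by gcongr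
  nlinarith

theorem exists_large_parameter {σ P Q : ℝ} {μ : ℝ} (hσ : 0 < σ) (hμ : 0 < μ) (hP : 0 ≤ P)
    (hQ : 0 ≤ Q) (K l₀ : ℝ) (hK : 0 ≤ K) (hl₀ : 0 < l₀) :
    ∃ l₁, l₀ ≤ l₁ ∧ P * l₁ + Q * (K * (σ + rhoOf σ l₁)) / l₁ < μ * (rhoOf σ l₁ - 1) := by
  set A := P + Q * K * (σ + 1 + (σ + 2) / σ) with hA
  have hA0 : 0 ≤ A := by positivity
  refine ⟨l₀ + 1 + σ * A / μ, by linarith [(by positivity : 0 ≤ σ * A / μ)], ?_⟩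
  set l := l₀ + 1 + σ * A / μ with hldef
  have hl1 : 1 < l := by linarith [(by positivity : 0 ≤ σ * A / μ)]
  have hl0 : 0 < l := by linarith
  have hAl : A < μ * l / σ := by
    rw [lt_div_iff₀ hσ]
    have : μ * (σ * A / μ) = σ * A := by field_simp
    nlinarith
  have h1 : (σ + rhoOf σ l) / l ≤ (σ + 1 + (σ + 2) / σ) * l := by
    rw [div_le_iff₀ hl0, rhoOf]
    have h2 : l * (l + σ + 1) / σ ≤ (σ + 2) / σ * (l * l) := by
      rw [div_mul_eq_mul_div]
      refine div_le_div_of_nonneg_right ?_ hσ.le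
      nlinarith [mul_pos (mul_pos hl0 (by linarith : 0 < σ + 1)) (sub_pos.2 hl1)]
    have h7 : 1 ≤ l * l := by nlinarith
    have h8 : (σ + 1) * 1 ≤ (σ + 1) * (l * l) := by gcongr
    linarith [(by ring : (σ + 1 + (σ + 2) / σ) * l * l
      = (σ + 1) * (l * l) + (σ + 2) / σ * (l * l))]
  have h3 : Q * (K * (σ + rhoOf σ l)) / l ≤ Q * K * ((σ + 1 + (σ + 2) / σ) * l) := by
    rw [show Q * (K * (σ + rhoOf σ l)) / l = Q * K * ((σ + rhoOf σ l) / l) by ring]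
    gcongr
  have h4 : μ * (rhoOf σ l - 1) = μ * l / σ * (l + σ + 1) := by rw [rhoOf]; ring
  have h5 : A * l ≤ μ * l / σ * l := by gcongr
  have h6 : 0 < μ * l / σ * (σ + 1) := by positivity
  rw [h4]
  nlinarith

/-- if `σ, β > 0` and `2β + 1 < 3σ`, then there exists `ρ > 1` such that the
Lorenz system with parameters `(σ, ρ, β)` has a homoclinic trajectory to the origin. -/
theorem lorenz_homoclinic_of_ineq (σ β : ℝ) (hσ : 0 < σ) (hβ : 0 < β)
    (h : 2 * β + 1 < 3 * σ) :
    ∃ ρ : ℝ, 1 < ρ ∧ ∃ u : ℝ → ℝ × ℝ × ℝ,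
      (∀ t : ℝ, HasDerivAt u (lorenzRHS σ ρ β (u t)) t) ∧
      (∃ t₁ t₂ : ℝ, u t₁ ≠ u t₂) ∧
      Tendsto u atTop (nhds 0) ∧ Tendsto u atBot (nhds 0) := by
  have h2 : β < 2 * σ := by linarith
  set μ := (3 * σ - 1 - 2 * β) / 2 with hμ
  set κ := 1 - β / (2 * σ) with hκ
  have hμ0 : 0 < μ := by linarith
  have hκ0 : 0 < κ := by
    have : β / (2 * σ) < 1 := (div_lt_one (by linarith)).2 h2
    linarith
  set m := min (2 * σ) (min 2 β) with hm
  have hm0 : 0 < m := lt_min (by linarith) (lt_min two_pos hβ)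
  have hβm : 0 < β / m := div_pos hβ hm0
  set L := 2 + β / m with hL
  obtain ⟨l₀, hk, hl₀⟩ : ∃ l₀, (σ + 4 / β - 2 / σ) ^ 2 * (rhoOf σ l₀ - 1) < 4 * (σ + 1) ∧
      0 < l₀ := by
    have hlim : Tendsto (fun l => (σ + 4 / β - 2 / σ) ^ 2 * (rhoOf σ l - 1)) (𝓝[>] 0)
        (𝓝 ((σ + 4 / β - 2 / σ) ^ 2 * (rhoOf σ 0 - 1))) :=
      (((((continuous_rhoOf σ).tendsto 0).sub_const 1).const_mul _)).mono_left nhdsWithin_le_nhds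
    exact ((hlim.eventually_lt_const (by simp only [rhoOf]; simp; linarith)).and
      self_mem_nhdsWithin).exists
  obtain ⟨l₁, hl, hW⟩ := exists_large_parameter hσ hμ0
    (P := (β + μ) * (4 * κ * (β + μ) / β + 4 * κ)) (Q := (β + μ) * (κ * σ)) (by positivity)
    (by positivity) (1 + L) l₀ (by positivity) hl₀
  have hl₁ : 0 < l₁ := hl₀.trans_le hl
  set Z := (1 + L) * (σ + rhoOf σ l₁) with hZ
  have hρ₁ := one_lt_rhoOf hσ hl₁
  have hρ₁Z : rhoOf σ l₁ ≤ Z := by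
    have : 0 ≤ (β / m + 2) * (σ + rhoOf σ l₁) := by positivity
    rw [hZ, hL]
    linarith
  obtain ⟨Φ, hΦ₁, hΦ₂, hΦ₃, hΦ₄, hΦ₅⟩ := exists_lorenz_flow σ β (Z + 1) (by linarith)
  have hΦ : IsLorenzFlow σ β (Z + 1) Φ := ⟨hΦ₁, hΦ₂, hΦ₃, hΦ₄, hΦ₅⟩
  have hρ₀ := one_lt_rhoOf hσ hl₀
  obtain ⟨δ, hδ, hδ0⟩ : ∃ δ, δ ^ 2 < β * (rhoOf σ l₀ - 1) ∧ 0 < δ := by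
    have hlim : Tendsto (fun δ : ℝ => δ ^ 2) (𝓝[>] 0) (𝓝 (0 ^ 2)) :=
      ((continuous_pow 2).tendsto 0).mono_left nhdsWithin_le_nhds
    exact ((hlim.eventually_lt_const (by
      rw [zero_pow two_ne_zero]; exact mul_pos hβ (by linarith))).and self_mem_nhdsWithin).exists
  obtain ⟨e, he, hsub⟩ : ∃ e > 0, ∀ ε ∈ Set.Ioo 0 e, ε < δ ∧
      ε ^ 2 * (σ / (4 * β) + (1 / β - 1 / (2 * σ)) ^ 2) < (σ + 1) * l₀ / 2 ∧
      ε ^ 2 / (2 * σ) < 1 ∧ ε ^ 2 * (1 + (1 + l₁ / σ) ^ 2) < 1 := by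
    have hsq : ∀ C : ℝ, Tendsto (fun ε : ℝ => ε ^ 2 * C) (𝓝[>] 0) (𝓝 (0 ^ 2 * C)) := fun C =>
      (((continuous_pow 2).tendsto 0).mul_const C).mono_left nhdsWithin_le_nhds
    have hz : ∀ C : ℝ, (0 : ℝ) ^ 2 * C = 0 := fun C => by simp
    have hδev : ∀ᶠ ε in 𝓝[>] (0 : ℝ), ε ∈ Set.Ioo 0 δ := Ioo_mem_nhdsGT hδ0
    have hev := hδev.and
      (((hsq (σ / (4 * β) + (1 / β - 1 / (2 * σ)) ^ 2)).eventually_lt_const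
        (by rw [hz]; positivity : _ < (σ + 1) * l₀ / 2)).and
      (((hsq (2 * σ)⁻¹).eventually_lt_const (by rw [hz]; norm_num : _ < (1 : ℝ))).and
      ((hsq (1 + (1 + l₁ / σ) ^ 2)).eventually_lt_const (by rw [hz]; norm_num : _ < (1 : ℝ)))))
    obtain ⟨e, he, hsub⟩ := (mem_nhdsGT_iff_exists_Ioo_subset).1 hev
    exact ⟨e, he, fun ε hε => ⟨(hsub hε).1.2, (hsub hε).2⟩⟩
  set ε : ℕ → ℝ := fun n => e / 2 * (1 / ((n : ℝ) + 1)) with hε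
  have hεm : ∀ n, ε n ∈ Set.Ioo 0 e := by
    intro n
    have h3 : 1 / ((n : ℝ) + 1) ≤ 1 := (div_le_one (by positivity)).2 (by simp)
    have h4 : e / 2 * (1 / ((n : ℝ) + 1)) ≤ e / 2 * 1 := by gcongr
    exact ⟨by simp only [hε]; positivity, by simp only [hε]; linarith⟩
  have hεlim : Tendsto ε atTop (𝓝 0) := by
    have h3 := (tendsto_one_div_add_atTop_nhds_zero_nat (𝕜 := ℝ)).const_mul (e / 2)
    rwa [mul_zero] at h3
  have htrap : ∀ n, ∀ l ∈ Set.Icc l₀ l₁, ∀ t, 0 ≤ t →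
      ‖Φ (rhoOf σ l) (startPoint σ l (ε n)) t‖ ≤ Z := by
    intro n l hlm t ht
    obtain ⟨-, -, h3, h4⟩ := hsub _ (hεm n)
    have hl0 : 0 < l := hl₀.trans_le hlm.1
    have hρ := one_lt_rhoOf hσ hl0
    have hρ' := rhoOf_mono hσ hl0.le hlm.2
    have hKZ : (1 + L) * (σ + rhoOf σ l) ≤ Z := by
      rw [hZ]; gcongr
    refine (hΦ.norm_le_of_trapped hβ hm0 (min_le_left _ _)
      ((min_le_right _ _).trans (min_le_left _ _)) ((min_le_right _ _).trans (min_le_right _ _))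
      (by linarith) (by linarith) ?_ (by linarith) ?_ ht).trans hKZ
    · rw [abs_of_pos (by linarith)]
      linarith
    · exact startPoint_trapped hσ (by linarith) hρ.le hl0.le hlm.2 h3.le h4.le
  have hpass : ∀ n : ℕ, ∃ l ∈ Set.Icc l₀ l₁, ∃ a t₁ b, IsPassage (√(β * (rhoOf σ l - 1))) δ n
      (fun t => (Φ (rhoOf σ l) (startPoint σ l (ε n)) t).1)
      (fun t => (Φ (rhoOf σ l) (startPoint σ l (ε n)) t).2.1) a t₁ b := by
    intro n
    obtain ⟨h3, h4, -, -⟩ := hsub _ (hεm n)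
    refine hΦ.exists_isPassage hσ hβ h hμ hκ hl₀ hl (hεm n).1 h3 hδ hk.le h4 (by linarith)
      (by linarith) (htrap n) ?_ n
    convert hW using 1
    ring
  choose l hlm hpass using hpass
  refine hΦ.exists_homoclinic hσ hβ h2 (δ := δ) (ρ₀ := rhoOf σ l₀) (ρ₁ := rhoOf σ l₁)
    (r := fun n => rhoOf σ (l n)) (p := fun n => startPoint σ (l n) (ε n)) hδ0 hδ
    (by linarith) (fun n => ⟨rhoOf_mono hσ hl₀.le (hlm n).1,
      rhoOf_mono hσ (hl₀.le.trans (hlm n).1) (hlm n).2⟩) ?_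
    (fun n t ht => (htrap n _ (hlm n) t ht).trans (by linarith)) hpass
  have h3 : Tendsto (fun n => (1 + l n / σ) * ε n) atTop (𝓝 0) := by
    refine squeeze_zero (fun n => mul_nonneg ?_ (hεm n).1.le) (g := fun n => (1 + l₁ / σ) * ε n)
      (fun n => ?_) (by simpa using hεlim.const_mul (1 + l₁ / σ))
    · have := div_nonneg (hl₀.le.trans (hlm n).1) hσ.le
      linarith
    · have := (hlm n).2
      have := (hεm n).1.le
      gcongr
  have h4 : Tendsto (fun n => ε n ^ 2 / (2 * σ)) atTop (𝓝 0) := by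
    simpa using (hεlim.pow 2).div_const (2 * σ)
  exact hεlim.prodMk_nhds (h3.prodMk_nhds h4)
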